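/- arXiv:2005.01342 — 2 statements merged into one kernel-verified Lean document; each statement's English description precedes it below -/
import Mathlib

section
/- Deterministic two-way transducers and copyless streaming string transducers describe the same class of functions: a partial function f : A* → B* is computable by a deterministic two-way transducer if and only if it is computable by a copyless streaming string transducer. -/
set_option autoImplicit false

/-! ### Asymptotic growth of functions `A* → ℕ` -/

/-- `g` has `k`-polynomial growth: `g(w) = O(|w|^k)` and there is an infinite set `L`
of words on which `g(w) = Ω(|w|^k)`. -/
def PolyGrowth {A : Type} (g : List A → ℕ) (k : ℕ) : Prop :=
  (∃ C : ℕ, ∀ w, g w ≤ C * w.length ^ k + C) ∧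
  (∃ L : Set (List A), L.Infinite ∧ ∃ c : ℕ, 0 < c ∧ ∀ w ∈ L, w.length ^ k ≤ c * g w)

/-- `g` has exponential growth: `g(w) = 2^{O(|w|)}` and there is an infinite set `L`
of words on which `g(w) = 2^{Ω(|w|)}`. -/
def ExpGrowth {A : Type} (g : List A → ℕ) : Prop :=
  (∃ C : ℕ, ∀ w, g w ≤ 2 ^ (C * w.length + C)) ∧
  (∃ L : Set (List A), L.Infinite ∧ ∃ c : ℕ, 0 < c ∧ ∀ w ∈ L, 2 ^ w.length ≤ (g w) ^ c)

/-! ### Substitutions -/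

/-- Extension of a substitution `s : X → (B ⊎ X)*` to a morphism on `(B ⊎ X)*`
fixing the letters of `B`; this also gives the composition of substitutions,
`(s₁ ∘ s₂) x = applySubst s₁ (s₂ x)`. -/
def applySubst {B X : Type} (s : X → List (B ⊕ X)) (l : List (B ⊕ X)) : List (B ⊕ X) :=
  l.flatMap (fun c => match c with | Sum.inl b => [Sum.inl b] | Sum.inr x => s x)

/-- Evaluation of a word over `B ⊎ X` under a valuation `v : X → B*` of the registers. -/
def evalSubst {B X : Type} (v : X → List B) (l : List (B ⊕ X)) : List B :=
  l.flatMap (fun c => match c with | Sum.inl b => [b] | Sum.inr x => v x)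

/-- Number of occurrences of register `x` in a word over `B ⊎ X`. -/
noncomputable def occCount {B X : Type} (x : X) (l : List (B ⊕ X)) : ℕ :=
  l.countP (fun c => @decide (c = Sum.inr x) (Classical.propDecidable _))

/-- Total number of occurrences of register `x` in the whole set of words `{s y | y ∈ X}`. -/
noncomputable def totalOcc {B X : Type} [Fintype X] (s : X → List (B ⊕ X)) (x : X) : ℕ :=
  ∑ y : X, occCount x (s y)

/-! ### Streaming string transducers -/

/-- A streaming string transducer (SST) with input alphabet `A` and output alphabet `B`:
finitely many states `Q` with initial state `q0`, finitely many registers `X` with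
initial contents `init`, a partial transition/update function (`trans`, returning the
successor state together with the register update substitution, with a common domain),
and a partial output function `out`. -/
structure SST (A B : Type) where
  Q : Type
  X : Type
  [finQ : Fintype Q]
  [finX : Fintype X]
  q0 : Q
  init : X → List B
  trans : Q → A → Option (Q × (X → List (B ⊕ X)))
  out : Q → Option (List (B ⊕ X))

attribute [instance] SST.finQ SST.finX

/-- Run of an SST from state `q` with current register valuation `v`. -/
def SST.runFrom {A B : Type} (T : SST A B) :
    T.Q → (T.X → List B) → List A → Option (T.Q × (T.X → List B))
  | q, v, [] => some (q, v)
  | q, v, a :: w =>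
    match T.trans q a with
    | none => none
    | some (q', s) => T.runFrom q' (fun x => evalSubst v (s x)) w

/-- The (partial) function computed by an SST. -/
def SST.eval {A B : Type} (T : SST A B) (w : List A) : Option (List B) :=
  (T.runFrom T.q0 T.init w).bind fun p => (T.out p.1).map fun o => evalSubst p.2 o

def SST.Computes {A B : Type} (T : SST A B) (f : List A → Option (List B)) : Prop :=
  ∀ w, T.eval w = f w

/-- An SST is copyless if every update substitution uses each register at most once
in total. -/
def SST.Copyless {A B : Type} (T : SST A B) : Prop :=
  ∀ q a p, T.trans q a = some p → ∀ x : T.X, totalOcc p.2 x ≤ 1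

/-- An SST is `k`-layered if its registers can be partitioned into layers
`X_0, …, X_k` such that every update of a register of layer `i` only uses registers
of layers `≤ i`, and each register of layer `i` is used at most once in total in the
updates of the registers of layer `i`. -/
def SST.IsLayered {A B : Type} (T : SST A B) (k : ℕ) : Prop :=
  ∃ layer : T.X → Fin (k + 1),
    ∀ q a p, T.trans q a = some p →
      (∀ x y, Sum.inr y ∈ p.2 x → layer y ≤ layer x) ∧
      (∀ y : T.X,
        (∑ x ∈ Finset.univ.filter (fun x => layer x = layer y), occCount y (p.2 x)) ≤ 1)

/-- The composed substitution `λ(q, w)` applied along the run reading `w` from state `q`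
(together with the state reached). -/
def SST.substFrom {A B : Type} (T : SST A B) :
    T.Q → List A → Option (T.Q × (T.X → List (B ⊕ T.X)))
  | q, [] => some (q, fun x => [Sum.inr x])
  | q, a :: w =>
    match T.trans q a with
    | none => none
    | some (q', s) => (T.substFrom q' w).map fun p => (p.1, fun x => applySubst s (p.2 x))

/-- An SST is `(k,B)`-bounded if its registers can be partitioned into layers
`X_0, …, X_k` such that every update of a register of layer `i` only uses registers of
layers `≤ i`, and for every state `q` and word `w`, each register of layer `i` occurs
at most `B` times in total in `{λ(q,w)(x) | x ∈ X_i}`. -/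
def SST.IsBounded {A B : Type} (T : SST A B) (k Bd : ℕ) : Prop :=
  ∃ layer : T.X → Fin (k + 1),
    (∀ q a p, T.trans q a = some p → ∀ x y, Sum.inr y ∈ p.2 x → layer y ≤ layer x) ∧
    (∀ q w p, T.substFrom q w = some p →
      ∀ y : T.X,
        (∑ x ∈ Finset.univ.filter (fun x => layer x = layer y), occCount y (p.2 x)) ≤ Bd)

/-! ### Simple SSTs -/

/-- A simple SST: total, a single state (hence no state component), and update
substitutions and output using no letters of `B`. -/
structure SimpleSST (A B : Type) where
  X : Type
  [finX : Fintype X]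
  [decX : DecidableEq X]
  init : X → List B
  upd : A → X → List X
  out : List X

attribute [instance] SimpleSST.finX SimpleSST.decX

/-- Register valuation of a simple SST after reading a word, starting from valuation `v`. -/
def SimpleSST.valFrom {A B : Type} (T : SimpleSST A B) :
    (T.X → List B) → List A → T.X → List B
  | v, [] => v
  | v, a :: w => T.valFrom (fun x => (T.upd a x).flatMap v) w

/-- Register valuation `𝒯^w` of a simple SST after reading `w`. -/
def SimpleSST.val {A B : Type} (T : SimpleSST A B) (w : List A) : T.X → List B :=
  T.valFrom T.init w

/-- The (total) function computed by a simple SST. -/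
def SimpleSST.eval {A B : Type} (T : SimpleSST A B) (w : List A) : List B :=
  (T.out).flatMap (T.val w)

/-! ### Two-way transducers -/

/-- A tape symbol: a letter of `A` or one of the two endmarkers `⊢`, `⊣`. -/
inductive TapeSym (A : Type) where
  | lend
  | rend
  | letter (a : A)

/-- The content of the tape `⊢w⊣` at position `m ∈ {0, …, |w|+1}`. -/
def tapeAt {A : Type} (w : List A) (m : ℕ) : TapeSym A :=
  if m = 0 then TapeSym.lend
  else
    match w[m - 1]? with
    | some a => TapeSym.letter a
    | none => TapeSym.rend

/-- Head moves. -/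
inductive Dir where
  | left
  | right

/-- A deterministic two-way transducer: finitely many states with an initial state and
a set of final states, and a partial transition/output function (common domain). -/
structure TwoWayT (A B : Type) where
  Q : Type
  [finQ : Fintype Q]
  q0 : Q
  final : Set Q
  trans : Q → TapeSym A → Option ((Q × Dir) × List B)

attribute [instance] TwoWayT.finQ

/-- `TwoWayT.Steps T w c v c'`: on input `⊢w⊣` the transducer can go from
configuration `c` to configuration `c'` producing output `v`. -/
inductive TwoWayT.Steps {A B : Type} (T : TwoWayT A B) (w : List A) :
    T.Q × ℕ → List B → T.Q × ℕ → Prop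
  | refl (c : T.Q × ℕ) : TwoWayT.Steps T w c [] c
  | stepL {q : T.Q} {m : ℕ} {q' : T.Q} {v u : List B} {cf : T.Q × ℕ} :
      T.trans q (tapeAt w m) = some ((q', Dir.left), v) → 1 ≤ m →
      TwoWayT.Steps T w (q', m - 1) u cf → TwoWayT.Steps T w (q, m) (v ++ u) cf
  | stepR {q : T.Q} {m : ℕ} {q' : T.Q} {v u : List B} {cf : T.Q × ℕ} :
      T.trans q (tapeAt w m) = some ((q', Dir.right), v) → m ≤ w.length →
      TwoWayT.Steps T w (q', m + 1) u cf → TwoWayT.Steps T w (q, m) (v ++ u) cf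

/-- The two-way transducer computes the partial function `f`: `f w = some v` iff there
is an accepting run on `⊢w⊣` (from `(q0, 0)` to `(q, |w|+1)` with `q` final)
producing `v`. -/
def TwoWayT.Computes {A B : Type} (T : TwoWayT A B) (f : List A → Option (List B)) : Prop :=
  ∀ w v, f w = some v ↔ ∃ q ∈ T.final, TwoWayT.Steps T w (T.q0, 0) v (q, w.length + 1)

/-! ### Marble transducers -/

/-- Actions of a marble transducer: move left, move right, lift the marble, or drop a
marble of color `c`. -/
inductive MAct (C : Type) where
  | left
  | right
  | lift
  | drop (c : C)

/-- A deterministic marble transducer: finitely many states with an initial state and a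
set of final states, finitely many marble colors `C`, and a partial transition/output
function (common domain) reading the current state, the tape symbol, and the color of
the marble at the current position (if any); on a position carrying a marble the head
may only move left or lift the marble. -/
structure MarbleT (A B : Type) where
  Q : Type
  C : Type
  [finQ : Fintype Q]
  [finC : Fintype C]
  q0 : Q
  final : Set Q
  trans : Q → TapeSym A → Option C → Option ((Q × MAct C) × List B)
  marble_left_or_lift : ∀ q s c p, trans q s (some c) = some p →
    p.1.2 = MAct.left ∨ p.1.2 = MAct.lift

attribute [instance] MarbleT.finQ MarbleT.finC

/-- The color of the marble at position `m`, for a stack `π` of dropped marbles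
(topmost first, positions strictly increasing from the top and all ≥ the head
position). -/
def marbleAt {C : Type} (m : ℕ) : List (C × ℕ) → Option C
  | [] => none
  | (c, p) :: _ => if p = m then some c else none

/-- `MarbleT.Steps T w c v c'`: on input `⊢w⊣` the marble transducer can go from
configuration `c` to configuration `c'` producing output `v`. A configuration is a
triple (state, head position, stack of dropped marbles). -/
inductive MarbleT.Steps {A B : Type} (T : MarbleT A B) (w : List A) :
    T.Q × ℕ × List (T.C × ℕ) → List B → T.Q × ℕ × List (T.C × ℕ) → Prop
  | refl (c : T.Q × ℕ × List (T.C × ℕ)) : MarbleT.Steps T w c [] c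
  | stepL {q : T.Q} {m : ℕ} {π : List (T.C × ℕ)} {q' : T.Q} {v u : List B}
      {cf : T.Q × ℕ × List (T.C × ℕ)} :
      T.trans q (tapeAt w m) (marbleAt m π) = some ((q', MAct.left), v) → 1 ≤ m →
      MarbleT.Steps T w (q', m - 1, π) u cf → MarbleT.Steps T w (q, m, π) (v ++ u) cf
  | stepR {q : T.Q} {m : ℕ} {π : List (T.C × ℕ)} {q' : T.Q} {v u : List B}
      {cf : T.Q × ℕ × List (T.C × ℕ)} :
      marbleAt m π = none →
      T.trans q (tapeAt w m) none = some ((q', MAct.right), v) → m ≤ w.length →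
      MarbleT.Steps T w (q', m + 1, π) u cf → MarbleT.Steps T w (q, m, π) (v ++ u) cf
  | stepLift {q : T.Q} {m : ℕ} {π : List (T.C × ℕ)} {q' : T.Q} {cc : T.C} {v u : List B}
      {cf : T.Q × ℕ × List (T.C × ℕ)} :
      T.trans q (tapeAt w m) (some cc) = some ((q', MAct.lift), v) →
      MarbleT.Steps T w (q', m, π) u cf →
      MarbleT.Steps T w (q, m, (cc, m) :: π) (v ++ u) cf
  | stepDrop {q : T.Q} {m : ℕ} {π : List (T.C × ℕ)} {q' : T.Q} {cc : T.C} {v u : List B}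
      {cf : T.Q × ℕ × List (T.C × ℕ)} :
      marbleAt m π = none →
      T.trans q (tapeAt w m) none = some ((q', MAct.drop cc), v) →
      MarbleT.Steps T w (q', m, (cc, m) :: π) u cf →
      MarbleT.Steps T w (q, m, π) (v ++ u) cf

/-- The marble transducer computes the partial function `f`: `f w = some v` iff there is
an accepting run on `⊢w⊣` (from `(q0, 0, ε)` to `(q, |w|+1, ε)` with `q` final)
producing `v`. -/
def MarbleT.Computes {A B : Type} (T : MarbleT A B) (f : List A → Option (List B)) : Prop :=
  ∀ w v, f w = some v ↔
    ∃ q ∈ T.final, MarbleT.Steps T w (T.q0, 0, []) v (q, w.length + 1, [])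

/-- A `k`-marble transducer: every configuration reachable from the initial
configuration carries at most `k` marbles. -/
def MarbleT.IsKMarble {A B : Type} (T : MarbleT A B) (k : ℕ) : Prop :=
  ∀ (w : List A) (u : List B) (cfg : T.Q × ℕ × List (T.C × ℕ)),
    MarbleT.Steps T w (T.q0, 0, []) u cfg → cfg.2.2.length ≤ k

/-- `f` is computable by a `k`-marble transducer. -/
def ComputableKMarble {A B : Type} (f : List A → List B) (k : ℕ) : Prop :=
  ∃ T : MarbleT A B, T.IsKMarble k ∧ T.Computes (fun w => some (f w))

/-! ### Matrices over ℕ and ℕ-automata -/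

/-- Product of two square matrices over `ℕ` (given as functions). -/
def matMul {Q : Type} [Fintype Q] (M N : Q → Q → ℕ) : Q → Q → ℕ :=
  fun i j => ∑ x : Q, M i x * N x j

/-- Identity matrix over `ℕ`. -/
def matId {Q : Type} [DecidableEq Q] : Q → Q → ℕ :=
  fun i j => if i = j then 1 else 0

/-- Row vector times matrix. -/
def vecMat {Q : Type} [Fintype Q] (v : Q → ℕ) (M : Q → Q → ℕ) : Q → ℕ :=
  fun j => ∑ x : Q, v x * M x j

/-- Matrix times column vector. -/
def matVec {Q : Type} [Fintype Q] (M : Q → Q → ℕ) (v : Q → ℕ) : Q → ℕ :=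
  fun i => ∑ x : Q, M i x * v x

/-- Dot product of two vectors over `ℕ`. -/
def dotProd {Q : Type} [Fintype Q] (v w : Q → ℕ) : ℕ :=
  ∑ x : Q, v x * w x

/-- An `ℕ`-automaton: a finite set of states `Q`, an initial row vector `α`, a weight
matrix `μ a` for every letter `a` (extended to words as a monoid morphism `μW`), and a
final column vector `β`. -/
structure NAut (A : Type) where
  Q : Type
  [finQ : Fintype Q]
  [decQ : DecidableEq Q]
  α : Q → ℕ
  μ : A → Q → Q → ℕ
  β : Q → ℕ

attribute [instance] NAut.finQ NAut.decQ

/-- The monoid morphism `A* → ℕ^{Q×Q}` extending `μ`. -/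
def NAut.μW {A : Type} (T : NAut A) : List A → T.Q → T.Q → ℕ
  | [] => matId
  | a :: w => matMul (T.μ a) (T.μW w)

/-- The total function `g : A* → ℕ` computed by the `ℕ`-automaton: `g w = α·μ(w)·β`. -/
def NAut.g {A : Type} (T : NAut A) (w : List A) : ℕ :=
  dotProd (vecMat T.α (T.μW w)) T.β

/-- Trimness: every state is accessible and co-accessible with nonzero weight. -/
def NAut.Trim {A : Type} (T : NAut A) : Prop :=
  ∀ q : T.Q, (∃ u, 1 ≤ vecMat T.α (T.μW u) q) ∧ (∃ v, 1 ≤ matVec (T.μW v) T.β q)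

/-- A heavy cycle on state `q`: a nonempty word `v` with `μ(v)(q,q) ≥ 2`. -/
def NAut.HeavyCycle {A : Type} (T : NAut A) (q : T.Q) (v : List A) : Prop :=
  v ≠ [] ∧ 2 ≤ T.μW v q q

/-- A barbell from `q` to `q' ≠ q`: a nonempty word `v` with `μ(v)(q,q) ≥ 1`,
`μ(v)(q,q') ≥ 1` and `μ(v)(q',q') ≥ 1`. -/
def NAut.Barbell {A : Type} (T : NAut A) (q q' : T.Q) (v : List A) : Prop :=
  q ≠ q' ∧ v ≠ [] ∧ 1 ≤ T.μW v q q ∧ 1 ≤ T.μW v q q' ∧ 1 ≤ T.μW v q' q'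

/-- Edge of the barbell graph `𝔊`. -/
def NAut.GEdge {A : Type} (T : NAut A) (q1 q2 : T.Q) : Prop :=
  ∃ q q' v, T.Barbell q q' v ∧ (∃ w, 1 ≤ T.μW w q1 q) ∧ (∃ w', 1 ≤ T.μW w' q' q2)

/-- `PathLen G q n`: there is a directed path of length `n` (counting edges) in the
graph `G` ending in `q`. -/
inductive PathLen {Q : Type} (G : Q → Q → Prop) : Q → ℕ → Prop
  | zero (q : Q) : PathLen G q 0
  | succ {p q : Q} {n : ℕ} : PathLen G p n → G p q → PathLen G q (n + 1)

/-- The height of `q` in the graph `G` is `n`: the maximal length of a directed path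
ending in `q` is `n`. -/
def HeightIs {Q : Type} (G : Q → Q → Prop) (q : Q) (n : ℕ) : Prop :=
  PathLen G q n ∧ ∀ m, PathLen G q m → m ≤ n

/-! ### Statement-specific predicates -/

/-- Case (1) of the trichotomy: `|f|` has exponential growth and `f` is not computable
with `k` marbles for any `k`. -/
def MarbleCase1 {A B : Type} (f : List A → List B) : Prop :=
  ExpGrowth (fun w => (f w).length) ∧ ∀ k : ℕ, ¬ ComputableKMarble f k

/-- Case (2) of the trichotomy: `|f|` has `(k+1)`-polynomial growth for some `k`, `f` is
computable with `k` marbles, and `k` is the least possible number of marbles. -/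
def MarbleCase2 {A B : Type} (f : List A → List B) : Prop :=
  ∃ k : ℕ, PolyGrowth (fun w => (f w).length) (k + 1) ∧ ComputableKMarble f k ∧
    ∀ j : ℕ, ComputableKMarble f j → k ≤ j

/-- Case (3) of the trichotomy: `|f|` has `0`-polynomial growth and `f` is computable
with `0` marbles. -/
def MarbleCase3 {A B : Type} (f : List A → List B) : Prop :=
  PolyGrowth (fun w => (f w).length) 0 ∧ ComputableKMarble f 0

/-- The second alternative of Lemma `lem:graph`: `g` has `k`-polynomial growth for some
`k ≥ 0` and the states admit a partition `S_0, …, S_k` satisfying (a), (b), (c). -/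
def NAutPolyCase {A : Type} (T : NAut A) : Prop :=
  ∃ k : ℕ, PolyGrowth T.g k ∧
    ∃ S : T.Q → Fin (k + 1),
      (∀ q q' : T.Q, (∃ w, 1 ≤ T.μW w q q') → S q ≤ S q') ∧
      (∃ Bd : ℕ, ∀ q q' : T.Q, S q = S q' → ∀ w, T.μW w q q' ≤ Bd) ∧
      (∀ q : T.Q, ∃ C : ℕ, ∀ w, vecMat T.α (T.μW w) q ≤ C * w.length ^ (S q : ℕ) + C)

namespace TwoWaySST

open Classical

/-! ### Labelled functional graphs -/

/-- A labelled functional graph with nodes `V`, exits `P`, labels over `C`. -/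
structure Gr (V P C : Type) where
  next : V → Option (V ⊕ P)
  lab : V → List C

inductive Reach {V P C : Type} (G : Gr V P C) : ℕ → V → P → List C → Prop
  | exit {v : V} {p : P} : G.next v = some (Sum.inr p) → Reach G 1 v p (G.lab v)
  | step {n : ℕ} {v v' : V} {p : P} {o : List C} : G.next v = some (Sum.inl v') →
      Reach G n v' p o → Reach G (n + 1) v p (G.lab v ++ o)

def RR {V P C : Type} (G : Gr V P C) (v : V) (p : P) (o : List C) : Prop :=
  ∃ n, Reach G n v p o

theorem RR.exit {V P C : Type} {G : Gr V P C} {v : V} {p : P}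
    (h : G.next v = some (Sum.inr p)) : RR G v p (G.lab v) := ⟨1, Reach.exit h⟩

theorem RR.step {V P C : Type} {G : Gr V P C} {v v' : V} {p : P} {o : List C}
    (h : G.next v = some (Sum.inl v')) (h2 : RR G v' p o) : RR G v p (G.lab v ++ o) := by
  obtain ⟨n, h2⟩ := h2
  exact ⟨n + 1, Reach.step h h2⟩

theorem Reach.det {V P C : Type} {G : Gr V P C} {n : ℕ} {v : V} {p : P} {o : List C}
    (h : Reach G n v p o) : ∀ {n' : ℕ} {p' : P} {o' : List C}, Reach G n' v p' o' → o = o' := by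
  induction h with
  | exit h =>
    intro n' p' o' h'
    cases h' with
    | exit h' => rfl
    | step h' _ => simp [h] at h'
  | step h _ ih =>
    intro n' p' o' h'
    cases h' with
    | exit h' => simp [h] at h'
    | step h' h2 =>
      rw [h] at h'
      simp only [Option.some.injEq, Sum.inl.injEq] at h'
      subst h'
      rw [ih h2]

theorem sim_fwd {V W P C : Type} {G : Gr V P C} {H : Gr W P C} (φ : V → W) (Val : V → Prop)
    (hc : ∀ v v', Val v → G.next v = some (Sum.inl v') → Val v')
    (hn : ∀ v, Val v → H.next (φ v) = (G.next v).map (Sum.map φ id))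
    (hl : ∀ v, Val v → H.lab (φ v) = G.lab v)
    {n : ℕ} {v : V} {p : P} {o : List C} (h : Reach G n v p o) (hv : Val v) :
    RR H (φ v) p o := by
  induction h with
  | exit h =>
    rw [← hl _ hv]
    exact RR.exit (by rw [hn _ hv, h]; rfl)
  | step h _ ih =>
    rw [← hl _ hv]
    exact RR.step (by rw [hn _ hv, h]; rfl) (ih (hc _ _ hv h))

theorem sim_bwd {V W P C : Type} {G : Gr V P C} {H : Gr W P C} (φ : V → W) (Val : V → Prop)
    (hc : ∀ v v', Val v → G.next v = some (Sum.inl v') → Val v')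
    (hn : ∀ v, Val v → H.next (φ v) = (G.next v).map (Sum.map φ id))
    (hl : ∀ v, Val v → H.lab (φ v) = G.lab v)
    {n : ℕ} {x : W} {p : P} {o : List C} (h : Reach H n x p o) :
    ∀ v, φ v = x → Val v → RR G v p o := by
  induction h with
  | exit h =>
    rintro v rfl hv
    rw [hl _ hv]
    rw [hn _ hv] at h
    refine RR.exit ?_
    cases hg : G.next v with
    | none => simp [hg] at h
    | some y =>
      cases y with
      | inl y => simp [hg] at h
      | inr y => simp [hg] at h; rw [h]
  | step h _ ih =>
    rintro v rfl hv
    rw [hl _ hv]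
    rw [hn _ hv] at h
    cases hg : G.next v with
    | none => simp [hg] at h
    | some y =>
      cases y with
      | inl y =>
        simp [hg] at h
        exact RR.step hg (ih _ h (hc _ _ hv hg))
      | inr y => simp [hg] at h

theorem sim_iff {V W P C : Type} {G : Gr V P C} {H : Gr W P C} (φ : V → W) (Val : V → Prop)
    (hc : ∀ v v', Val v → G.next v = some (Sum.inl v') → Val v')
    (hn : ∀ v, Val v → H.next (φ v) = (G.next v).map (Sum.map φ id))
    (hl : ∀ v, Val v → H.lab (φ v) = G.lab v)
    {v : V} {p : P} {o : List C} (hv : Val v) :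
    RR G v p o ↔ RR H (φ v) p o :=
  ⟨fun ⟨_, h⟩ => sim_fwd φ Val hc hn hl h hv, fun ⟨_, h⟩ => sim_bwd φ Val hc hn hl h v rfl hv⟩

/-! ### Evaluating symbolic labels -/

theorem evalSubst_append {B X : Type} (v : X → List B) (l l' : List (B ⊕ X)) :
    evalSubst v (l ++ l') = evalSubst v l ++ evalSubst v l' := by
  simp [evalSubst]

theorem evalSubst_nil {B X : Type} (v : X → List B) : evalSubst v [] = [] := rfl

theorem evalSubst_inl {B X : Type} (v : X → List B) (b : B) (l : List (B ⊕ X)) :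
    evalSubst v (Sum.inl b :: l) = b :: evalSubst v l := by
  simp [evalSubst]

theorem evalSubst_inr {B X : Type} (v : X → List B) (x : X) (l : List (B ⊕ X)) :
    evalSubst v (Sum.inr x :: l) = v x ++ evalSubst v l := by
  simp [evalSubst]

theorem evalSubst_map_inl {B X : Type} (v : X → List B) (l : List B) :
    evalSubst v (l.map Sum.inl) = l := by
  induction l with
  | nil => rfl
  | cons b l ih => simp [evalSubst_inl, ih]

def Gr.ev {V P B X : Type} (G : Gr V P (B ⊕ X)) (val : X → List B) : Gr V P B :=
  ⟨G.next, fun v => evalSubst val (G.lab v)⟩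

theorem ev_iff {V P B X : Type} (G : Gr V P (B ⊕ X)) (val : X → List B) (v : V) (p : P)
    (o : List B) : RR (G.ev val) v p o ↔ ∃ o', RR G v p o' ∧ evalSubst val o' = o := by
  constructor
  · rintro ⟨n, h⟩
    induction h with
    | exit h => exact ⟨_, RR.exit (G := G) h, rfl⟩
    | step h _ ih =>
      obtain ⟨o', h1, h2⟩ := ih
      exact ⟨_, RR.step (G := G) h h1, by rw [evalSubst_append, h2]; rfl⟩
  · rintro ⟨o', ⟨n, h⟩, rfl⟩
    induction h with
    | exit h => exact RR.exit (G := G.ev val) h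
    | step h _ ih =>
      rw [evalSubst_append]
      exact RR.step (G := G.ev val) h ih

/-! ### Reducing the number of nodes -/

theorem occ_append {B X : Type} (x : X) (l l' : List (B ⊕ X)) :
    occCount x (l ++ l') = occCount x l + occCount x l' := by
  simp [occCount]

theorem contract_iff {V P C : Type} {G : Gr V P C} {S : Finset V} {u v : V}
    (hc : ∀ x ∈ S, ∀ y, G.next x = some (Sum.inl y) → y ∈ S)
    (hv : v ∈ S) (hu : u ∈ S)
    (huv : u ≠ v) (hnu : G.next u = some (Sum.inl v))
    (huniq : ∀ x ∈ S, G.next x = some (Sum.inl v) → x = u)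
    (G' : Gr V P C) (hG' : G' = ⟨Function.update G.next u (G.next v),
      Function.update G.lab u (G.lab u ++ G.lab v)⟩)
    (x : V) (hx : x ∈ S) (hxv : x ≠ v) (p : P) (o : List C) :
    RR G x p o ↔ RR G' x p o := by
  have hnv : G.next v ≠ some (Sum.inl v) := fun h => huv (huniq v hv h).symm
  constructor
  · rintro ⟨n, h⟩
    induction n using Nat.strong_induction_on generalizing x o with
    | _ n ih =>
      by_cases hxu : x = u
      · subst hxu
        have hlab : G'.lab x = G.lab x ++ G.lab v := by simp [hG']
        have hnx : G'.next x = G.next v := by simp [hG']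
        cases h with
        | exit h => simp [hnu] at h
        | step h h2 =>
          rw [hnu] at h
          simp only [Option.some.injEq, Sum.inl.injEq] at h
          subst h
          cases h2 with
          | exit h3 =>
            rw [← hlab]
            exact RR.exit (by rw [hnx, h3])
          | step h3 h4 =>
            rw [← List.append_assoc, ← hlab]
            refine RR.step (by rw [hnx, h3]) (ih _ (by omega) _ (hc _ hv _ h3) ?_ _ h4)
            rintro rfl
            exact hnv h3
      · have hlab : G'.lab x = G.lab x := by simp [hG', hxu]
        have hnx : G'.next x = G.next x := by simp [hG', hxu]
        cases h with
        | exit h => rw [← hlab]; exact RR.exit (by rw [hnx, h])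
        | step h h2 =>
          rw [← hlab]
          refine RR.step (by rw [hnx, h]) (ih _ (by omega) _ (hc _ hx _ h) ?_ _ h2)
          rintro rfl
          exact hxu (huniq _ hx h)
  · rintro ⟨n, h⟩
    induction h with
    | @exit x p h =>
      by_cases hxu : x = u
      · subst hxu
        have hlab : G'.lab x = G.lab x ++ G.lab v := by simp [hG']
        have hnx : G'.next x = G.next v := by simp [hG']
        rw [hlab]
        exact RR.step hnu (RR.exit (by rw [← hnx, h]))
      · have hlab : G'.lab x = G.lab x := by simp [hG', hxu]
        have hnx : G'.next x = G.next x := by simp [hG', hxu]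
        rw [hlab]
        exact RR.exit (by rw [← hnx, h])
    | @step n x y p o h _ ih =>
      by_cases hxu : x = u
      · subst hxu
        have hlab : G'.lab x = G.lab x ++ G.lab v := by simp [hG']
        have hnx : G'.next x = G.next v := by simp [hG']
        rw [hlab, List.append_assoc]
        rw [hnx] at h
        refine RR.step hnu (RR.step h (ih (hc _ hv _ h) ?_))
        rintro rfl
        exact hnv h
      · have hlab : G'.lab x = G.lab x := by simp [hG', hxu]
        have hnx : G'.next x = G.next x := by simp [hG', hxu]
        rw [hlab]
        rw [hnx] at h
        refine RR.step h (ih (hc _ hx _ h) ?_)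
        rintro rfl
        exact hxu (huniq _ hx h)

theorem reduce {V P X B E : Type} [Fintype E] (ent : E → V) (n : ℕ) :
    ∀ (S : Finset V) (G : Gr V P (B ⊕ X)), S.card = n → (∀ e, ent e ∈ S) →
    (∀ x ∈ S, ∀ y, G.next x = some (Sum.inl y) → y ∈ S) →
    (∀ z, ∑ x ∈ S, occCount z (G.lab x) ≤ 1) →
    ∃ (S' : Finset V) (G' : Gr V P (B ⊕ X)), S'.card ≤ 2 * Fintype.card E ∧
      (∀ e, ent e ∈ S') ∧
      (∀ x ∈ S', ∀ y, G'.next x = some (Sum.inl y) → y ∈ S') ∧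
      (∀ z, ∑ x ∈ S', occCount z (G'.lab x) ≤ 1) ∧
      ∀ e p o, RR G (ent e) p o ↔ RR G' (ent e) p o := by
  induction n using Nat.strong_induction_on with
  | _ n ih =>
    intro S G hS hent hc hcl
    by_cases hbad : ∃ v ∈ S, (∀ e, ent e ≠ v) ∧
        (S.filter (fun u => G.next u = some (Sum.inl v))).card ≤ 1
    · obtain ⟨v, hv, hve, hcard⟩ := hbad
      have hlt : (S.erase v).card < n := by rw [← hS]; exact Finset.card_erase_lt_of_mem hv
      by_cases hp : ∃ u ∈ S, u ≠ v ∧ G.next u = some (Sum.inl v)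
      · obtain ⟨u, hu, huv, hnu⟩ := hp
        have huniq : ∀ x ∈ S, G.next x = some (Sum.inl v) → x = u := by
          intro x hx hnx
          rw [Finset.card_le_one] at hcard
          exact hcard _ (by simp [hx, hnx]) _ (by simp [hu, hnu])
        have hnv : G.next v ≠ some (Sum.inl v) := fun h => huv (huniq v hv h).symm
        obtain ⟨S', G', h1, h2, h3, h4, h5⟩ := ih _ hlt (S.erase v)
          ⟨Function.update G.next u (G.next v), Function.update G.lab u (G.lab u ++ G.lab v)⟩ rfl
          (fun e => Finset.mem_erase.2 ⟨hve e, hent e⟩)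
          (by
            intro x hx y hy
            rw [Finset.mem_erase] at hx ⊢
            by_cases hxu : x = u
            · subst hxu
              simp only [Function.update_self] at hy
              exact ⟨by rintro rfl; exact hnv hy, hc _ hv _ hy⟩
            · simp only [Function.update_of_ne hxu] at hy
              exact ⟨by rintro rfl; exact hxu (huniq _ hx.2 hy), hc _ hx.2 _ hy⟩)
          (by
            intro z
            refine le_trans (le_of_eq ?_) (hcl z)
            have hu' : u ∈ S.erase v := Finset.mem_erase.2 ⟨huv, hu⟩
            rw [← Finset.add_sum_erase S _ hv, ← Finset.add_sum_erase (S.erase v) _ hu',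
              ← Finset.add_sum_erase (S.erase v) _ hu']
            simp only [Function.update_self, occ_append]
            rw [Finset.sum_congr rfl (g := fun x => occCount z (G.lab x))]
            · ring
            · intro x hx
              rw [Function.update_of_ne (Finset.ne_of_mem_erase hx)])
        refine ⟨S', G', h1, h2, h3, h4, fun e p o => ?_⟩
        rw [← h5]
        exact contract_iff hc hv hu huv hnu huniq _ rfl _ (hent e) (hve e) p o
      · push Not at hp
        exact ih _ hlt (S.erase v) G rfl (fun e => Finset.mem_erase.2 ⟨hve e, hent e⟩)
          (fun x hx y hy => Finset.mem_erase.2 ⟨by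
              rintro rfl
              rw [Finset.mem_erase] at hx
              exact hp x hx.2 hx.1 hy, hc x (Finset.mem_of_mem_erase hx) y hy⟩)
          (fun z => le_trans (Finset.sum_le_sum_of_subset (Finset.erase_subset _ _)) (hcl z))
    · push Not at hbad
      refine ⟨S, G, ?_, hent, hc, hcl, fun _ _ _ => Iff.rfl⟩
      set I := Finset.univ.image ent with hI
      have hIc : I.card ≤ Fintype.card E := Finset.card_image_le
      have h1 : ∑ v ∈ S \ I, (S.filter (fun u => G.next u = some (Sum.inl v))).card ≤ S.card := by
        rw [← Finset.card_biUnion]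
        · apply Finset.card_le_card
          intro x hx
          simp only [Finset.mem_biUnion, Finset.mem_filter] at hx
          obtain ⟨_, _, hx, _⟩ := hx
          exact hx
        · intro a _ b _ hab
          rw [Function.onFun, Finset.disjoint_left]
          intro x hx hx'
          simp only [Finset.mem_filter] at hx hx'
          rw [hx.2] at hx'
          simp at hx'
          exact hab hx'.2
      have h2 : (S \ I).card * 2 ≤
          ∑ v ∈ S \ I, (S.filter (fun u => G.next u = some (Sum.inl v))).card := by
        rw [← smul_eq_mul]
        apply Finset.card_nsmul_le_sum
        intro v hv
        rw [Finset.mem_sdiff] at hv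
        refine hbad v hv.1 fun e he => hv.2 ?_
        rw [hI, ← he]
        simp
      have h3 : S.card - I.card ≤ (S \ I).card := Finset.le_card_sdiff _ _
      omega

theorem exists_small {V P X B E : Type} [Fintype V] [Fintype E] [Nonempty E] (ent : E → V)
    (G : Gr V P (B ⊕ X)) (hcl : ∀ z, ∑ x, occCount z (G.lab x) ≤ 1) :
    ∃ (ent' : E → Fin (2 * Fintype.card E)) (G' : Gr (Fin (2 * Fintype.card E)) P (B ⊕ X)),
      (∀ z, ∑ x, occCount z (G'.lab x) ≤ 1) ∧
      ∀ e p o, RR G (ent e) p o ↔ RR G' (ent' e) p o := by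
  obtain ⟨S, G1, h1, h2, h3, h4, h5⟩ := reduce ent _ Finset.univ G rfl (by simp) (by simp) hcl
  have hne : Nonempty (Fin (2 * Fintype.card E)) :=
    ⟨⟨0, by have := Fintype.card_pos (α := E); omega⟩⟩
  let ι : V → Fin (2 * Fintype.card E) := fun v =>
    if h : v ∈ S then Fin.castLE h1 (S.equivFin ⟨v, h⟩) else Classical.choice hne
  have hι : ∀ u ∈ S, ∀ v ∈ S, ι u = ι v → u = v := by
    intro u hu v hv h
    simp only [ι, hu, hv, dif_pos] at h
    have := Fin.castLE_injective h1 h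
    simpa using this
  let inv : Fin (2 * Fintype.card E) → Option V := fun i =>
    if h : ∃ v ∈ S, ι v = i then some h.choose else none
  have hinv : ∀ v ∈ S, inv (ι v) = some v := by
    intro v hv
    have h : ∃ v' ∈ S, ι v' = ι v := ⟨v, hv, rfl⟩
    simp only [inv, h, dif_pos]
    rw [hι _ h.choose_spec.1 _ hv h.choose_spec.2]
  have hinv2 : ∀ i v, inv i = some v → v ∈ S ∧ ι v = i := by
    intro i v hv
    simp only [inv] at hv
    split at hv
    · rename_i h
      simp at hv
      rw [← hv]
      exact h.choose_spec
    · simp at hv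
  let G2 : Gr (Fin (2 * Fintype.card E)) P (B ⊕ X) :=
    ⟨fun i => (inv i).bind fun v => (G1.next v).map (Sum.map ι id),
     fun i => match inv i with | some v => G1.lab v | none => []⟩
  refine ⟨fun e => ι (ent e), G2, ?_, fun e p o => ?_⟩
  · intro z
    refine le_trans ?_ (h4 z)
    have : ∑ x ∈ S, occCount z (G1.lab x) = ∑ i ∈ S.image ι, occCount z (G2.lab i) := by
      rw [Finset.sum_image hι]
      refine Finset.sum_congr rfl fun v hv => ?_
      simp only [G2, hinv v hv]
    rw [this]
    apply le_of_eq
    symm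
    apply Finset.sum_subset (Finset.subset_univ _)
    intro i _ hi
    have : inv i = none := by
      cases h : inv i with
      | none => rfl
      | some v =>
        exfalso
        apply hi
        rw [← (hinv2 i v h).2]
        exact Finset.mem_image_of_mem _ (hinv2 i v h).1
    simp only [G2, this]
    simp [occCount]
  · rw [h5]
    refine sim_iff ι (fun v => v ∈ S) (fun v v' hv h => h3 v hv v' h) ?_ ?_ (h2 e)
    · intro v hv
      simp only [G2, hinv v hv]
      rfl
    · intro v hv
      simp only [G2, hinv v hv]

/-! ### Adding a column -/

def comb {V Q C : Type} (col : Q → Option ((Q ⊕ Q) × List C)) (ent : Option Q → V)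
    (G : Gr V Q C) : Gr (V ⊕ Q) Q C where
  next x := match x with
    | Sum.inl v => (G.next v).map fun y => Sum.inl y
    | Sum.inr q => (col q).map fun y => match y.1 with
      | Sum.inl p => Sum.inl (Sum.inl (ent (some p)))
      | Sum.inr p => Sum.inr p
  lab x := match x with
    | Sum.inl v => G.lab v
    | Sum.inr q => match col q with
      | some y => y.2
      | none => []

def entComb {V Q : Type} (ent : Option Q → V) : Option Q → V ⊕ Q
  | none => Sum.inl (ent none)
  | some q => Sum.inr q

theorem comb_decomp {V Q C : Type} {col : Q → Option ((Q ⊕ Q) × List C)} {ent : Option Q → V}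
    {G : Gr V Q C} {n : ℕ} {x : V ⊕ Q} {p : Q} {o : List C} (h : Reach (comb col ent G) n x p o) :
    ∀ v, x = Sum.inl v → ∃ q k o1 o2, RR G v q o1 ∧ k < n ∧
      Reach (comb col ent G) k (Sum.inr q) p o2 ∧ o = o1 ++ o2 := by
  induction h with
  | exit h =>
    rintro v rfl
    simp [comb] at h
  | step h h2 ih =>
    rintro v rfl
    cases hg : G.next v with
    | none => simp [comb, hg] at h
    | some y =>
      cases y with
      | inl y =>
        simp [comb, hg] at h
        obtain ⟨q, k, o1, o2, a1, a2, a3, a4⟩ := ih y h.symm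
        exact ⟨q, k, G.lab v ++ o1, o2, RR.step hg a1, by omega, a3, by simp [a4, comb]⟩
      | inr y =>
        simp [comb, hg] at h
        subst h
        exact ⟨y, _, G.lab v, _, RR.exit hg, Nat.lt_succ_self _, h2, rfl⟩

theorem comb_comp {V Q C : Type} {col : Q → Option ((Q ⊕ Q) × List C)} {ent : Option Q → V}
    {G : Gr V Q C} {n : ℕ} {v : V} {q p : Q} {o1 o2 : List C} (h : Reach G n v q o1)
    (h2 : RR (comb col ent G) (Sum.inr q) p o2) :
    RR (comb col ent G) (Sum.inl v) p (o1 ++ o2) := by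
  induction h with
  | @exit v q h =>
    exact RR.step (G := comb col ent G) (v := Sum.inl v) (by simp [comb, h]) h2
  | @step n v v' q o h _ ih =>
    rw [List.append_assoc]
    exact RR.step (G := comb col ent G) (v := Sum.inl v) (v' := Sum.inl v')
      (by simp [comb, h]) (ih h2)

theorem comb_fwd {V W Q C : Type} {col : Q → Option ((Q ⊕ Q) × List C)} {ent : Option Q → V}
    {ent2 : Option Q → W} {G : Gr V Q C} {H : Gr W Q C}
    (hGH : ∀ e p o, RR G (ent e) p o → RR H (ent2 e) p o) (e : Option Q) (p : Q) (o : List C)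
    (h : RR (comb col ent G) (entComb ent e) p o) :
    RR (comb col ent2 H) (entComb ent2 e) p o := by
  have main : ∀ n q o, Reach (comb col ent G) n (Sum.inr q) p o →
      RR (comb col ent2 H) (Sum.inr q) p o := by
    intro n
    induction n using Nat.strong_induction_on with
    | _ n ih =>
      intro q o h
      have hlab : (comb col ent G).lab (Sum.inr q) = (comb col ent2 H).lab (Sum.inr q) := rfl
      cases h with
      | exit h =>
        rw [hlab]
        refine RR.exit ?_
        revert h
        simp only [comb]
        cases col q with
        | none => simp
        | some y =>
          obtain ⟨y | y, l⟩ := y <;> simp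
      | @step n _ v' _ o h h2 =>
        rw [hlab]
        cases hq : col q with
        | none => simp [comb, hq] at h
        | some y =>
          obtain ⟨y | y, l⟩ := y
          · simp [comb, hq] at h
            subst h
            obtain ⟨q', k, o1, o2, a1, a2, a3, rfl⟩ := comb_decomp h2 _ rfl
            obtain ⟨n', b⟩ := hGH _ _ _ a1
            exact RR.step (v' := Sum.inl (ent2 (some y))) (by simp [comb, hq])
              (comb_comp b (ih k (by omega) _ _ a3))
          · simp [comb, hq] at h
  obtain ⟨n, h⟩ := h
  cases e with
  | some q => exact main n q o h
  | none =>
    obtain ⟨q', k, o1, o2, a1, a2, a3, rfl⟩ := comb_decomp h _ rfl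
    obtain ⟨n', b⟩ := hGH _ _ _ a1
    exact comb_comp b (main k _ _ a3)

/-! ### From two-way transducers to copyless SSTs -/

section ToSST

variable {A B : Type} (T : TwoWayT A B)

/-- Column of the two-way transducer at a given tape symbol. -/
def colT (t : TapeSym A) (q : T.Q) : Option ((T.Q ⊕ T.Q) × List B) :=
  match T.trans q t with
  | none => none
  | some ((p, Dir.left), v) => some (Sum.inl p, v)
  | some ((p, Dir.right), v) => some (Sum.inr p, v)

/-- Column at the right endmarker: final states exit. -/
noncomputable def colEnd (q : T.Q) : Option ((T.Q ⊕ T.Q) × List B) :=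
  if q ∈ T.final then some (Sum.inr q, [])
  else match T.trans q TapeSym.rend with
    | none => none
    | some ((p, Dir.left), v) => some (Sum.inl p, v)
    | some ((_, Dir.right), _) => none

/-- Configuration graph of the prefix `⊢u`. -/
def confGr (u : List A) : Gr (T.Q × ℕ) T.Q B where
  next c := if c.2 ≤ u.length then
      match T.trans c.1 (tapeAt u c.2) with
      | none => none
      | some ((p, Dir.left), _) => if c.2 = 0 then none else some (Sum.inl (p, c.2 - 1))
      | some ((p, Dir.right), _) =>
        if c.2 < u.length then some (Sum.inl (p, c.2 + 1)) else some (Sum.inr p)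
    else none
  lab c := match T.trans c.1 (tapeAt u c.2) with
    | none => []
    | some (_, v) => v

def startC (u : List A) : Option T.Q → T.Q × ℕ
  | none => (T.q0, 0)
  | some q => (q, u.length)

def phi (u : List A) : (T.Q × ℕ) ⊕ T.Q → T.Q × ℕ
  | Sum.inl c => c
  | Sum.inr q => (q, u.length + 1)

def PVal (u : List A) : (T.Q × ℕ) ⊕ T.Q → Prop
  | Sum.inl c => c.2 ≤ u.length
  | Sum.inr _ => True

theorem tapeAt_snoc_le (u : List A) (a : A) (m : ℕ) (h : m ≤ u.length) :
    tapeAt (u ++ [a]) m = tapeAt u m := by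
  unfold tapeAt
  by_cases hm : m = 0
  · simp [hm]
  · rw [List.getElem?_append_left (by omega)]

theorem tapeAt_snoc (u : List A) (a : A) :
    tapeAt (u ++ [a]) (u.length + 1) = TapeSym.letter a := by
  simp [tapeAt]

theorem tapeAt_end (u : List A) : tapeAt u (u.length + 1) = TapeSym.rend := by
  simp [tapeAt]

theorem PVal_closed (u : List A) (col : T.Q → Option ((T.Q ⊕ T.Q) × List B)) (v v')
    (hv : PVal T u v) (h : (comb col (startC T u) (confGr T u)).next v = some (Sum.inl v')) :
    PVal T u v' := by
  rcases v with ⟨q, m⟩ | q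
  · simp only [PVal] at hv
    simp only [comb, confGr, hv, if_true] at h
    cases ht : T.trans q (tapeAt u m) with
    | none => simp [ht] at h
    | some y =>
      obtain ⟨⟨p, d⟩, l⟩ := y
      cases d with
      | left =>
        simp only [ht] at h
        by_cases hm : m = 0
        · simp [hm] at h
        · simp [hm] at h
          subst h
          simp only [PVal]
          omega
      | right =>
        simp only [ht] at h
        by_cases hm : m < u.length
        · simp [hm] at h
          subst h
          simp only [PVal]
          omega
        · simp [hm] at h
          subst h
          simp only [PVal]
  · simp only [comb] at h
    cases hc : col q with
    | none => simp [hc] at h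
    | some y =>
      obtain ⟨y | y, l⟩ := y
      · simp [hc] at h
        subst h
        simp [PVal, startC]
      · simp [hc] at h

theorem conf_snoc (u : List A) (a : A) (e : Option T.Q) (p : T.Q) (o : List B) :
    RR (comb (colT T (TapeSym.letter a)) (startC T u) (confGr T u)) (entComb (startC T u) e) p o ↔
    RR (confGr T (u ++ [a])) (startC T (u ++ [a]) e) p o := by
  have key : startC T (u ++ [a]) e = phi T u (entComb (startC T u) e) := by
    cases e <;> simp [startC, entComb, phi]
  rw [key]
  refine sim_iff (phi T u) (PVal T u) (PVal_closed T u _) ?_ ?_ ?_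
  · rintro (⟨q, m⟩ | q) hv
    · simp only [PVal] at hv
      simp only [comb, confGr, phi, hv, if_true, tapeAt_snoc_le u a m hv, List.length_append,
        List.length_singleton, show m ≤ u.length + 1 by omega, show m < u.length + 1 by omega]
      cases ht : T.trans q (tapeAt u m) with
      | none => rfl
      | some y =>
        obtain ⟨⟨p, d⟩, l⟩ := y
        cases d with
        | left =>
          by_cases hm : m = 0
          · simp [hm]
          · simp [hm, phi]
        | right =>
          by_cases hm : m < u.length
          · simp [hm, phi]
          · simp [hm, phi]
            omega
    · simp only [comb, confGr, phi, tapeAt_snoc, List.length_append, colT,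
        List.length_singleton, le_refl, if_true]
      cases ht : T.trans q (TapeSym.letter a) with
      | none => rfl
      | some y =>
        obtain ⟨⟨p, d⟩, l⟩ := y
        cases d <;> simp [phi, startC]
  · rintro (⟨q, m⟩ | q) hv
    · simp only [PVal] at hv
      simp only [comb, confGr, phi, tapeAt_snoc_le u a m hv]
    · simp only [comb, confGr, phi, tapeAt_snoc, colT]
      cases ht : T.trans q (TapeSym.letter a) with
      | none => rfl
      | some y =>
        obtain ⟨⟨p, d⟩, l⟩ := y
        cases d <;> rfl
  · cases e <;> simp [entComb, startC, PVal]

/-- The graph of the prefix `⊢`. -/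
def baseGr : Gr T.Q T.Q B where
  next q := match T.trans q TapeSym.lend with
    | some ((p, Dir.right), _) => some (Sum.inr p)
    | _ => none
  lab q := match T.trans q TapeSym.lend with
    | none => []
    | some (_, v) => v

def baseEnt : Option T.Q → T.Q
  | none => T.q0
  | some q => q

theorem base_iff (e : Option T.Q) (p : T.Q) (o : List B) :
    RR (baseGr T) (baseEnt T e) p o ↔ RR (confGr T []) (startC T [] e) p o := by
  have key : startC T ([] : List A) e = (fun q => (q, 0)) (baseEnt T e) := by
    cases e <;> simp [startC, baseEnt]
  rw [key]
  refine sim_iff (fun q => (q, 0)) (fun _ => True) (fun _ _ _ _ => trivial) ?_ ?_ trivial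
  · intro q _
    simp only [confGr, baseGr, tapeAt]
    cases ht : T.trans q TapeSym.lend with
    | none => simp [ht]
    | some y =>
      obtain ⟨⟨p, d⟩, l⟩ := y
      cases d <;> simp [ht]
  · intro q _
    simp only [confGr, baseGr, tapeAt]
    rfl

theorem end_fwd (w : List A) {n : ℕ} {x : (T.Q × ℕ) ⊕ T.Q} {p : T.Q} {o : List B}
    (h : Reach (comb (colEnd T) (startC T w) (confGr T w)) n x p o) (hx : PVal T w x) :
    p ∈ T.final ∧ TwoWayT.Steps T w (phi T w x) o (p, w.length + 1) := by
  induction h with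
  | @exit x p h =>
    rcases x with c | q
    · simp [comb] at h
    · simp only [comb, colEnd] at h ⊢
      by_cases hf : q ∈ T.final
      · simp [hf] at h ⊢
        subst h
        exact ⟨hf, TwoWayT.Steps.refl _⟩
      · simp only [hf, if_false] at h
        cases ht : T.trans q TapeSym.rend with
        | none => simp [ht] at h
        | some y =>
          obtain ⟨⟨p, d⟩, l⟩ := y
          cases d <;> simp [ht] at h
  | @step n x x' p o h h2 ih =>
    obtain ⟨ih1, ih2⟩ := ih (PVal_closed T w _ _ _ hx h)
    refine ⟨ih1, ?_⟩
    rcases x with ⟨q, m⟩ | q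
    · simp only [PVal] at hx
      simp only [comb, confGr, hx, if_true] at h ⊢
      cases ht : T.trans q (tapeAt w m) with
      | none => simp [ht] at h
      | some y =>
        obtain ⟨⟨p, d⟩, l⟩ := y
        cases d with
        | left =>
          simp only [ht] at h
          by_cases hm : m = 0
          · simp [hm] at h
          · simp [hm] at h
            subst h
            exact TwoWayT.Steps.stepL ht (by omega) ih2
        | right =>
          simp only [ht] at h
          by_cases hm : m < w.length
          · simp [hm] at h
            subst h
            exact TwoWayT.Steps.stepR ht (by omega) ih2
          · simp [hm] at h
            subst h
            have : m = w.length := by omega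
            subst this
            exact TwoWayT.Steps.stepR ht (by omega) ih2
    · simp only [comb, colEnd] at h ⊢
      by_cases hf : q ∈ T.final
      · simp [hf] at h
      · simp only [hf, if_false] at h ⊢
        cases ht : T.trans q TapeSym.rend with
        | none => simp [ht] at h
        | some y =>
          obtain ⟨⟨p, d⟩, l⟩ := y
          cases d with
          | left =>
            simp [ht] at h
            subst h
            exact TwoWayT.Steps.stepL (by rw [tapeAt_end, ht]) (by omega) ih2
          | right => simp [ht] at h

theorem end_bwd (w : List A) {c c' : T.Q × ℕ} {o : List B} (h : TwoWayT.Steps T w c o c')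
    (hc' : c'.1 ∈ T.final ∧ c'.2 = w.length + 1) :
    ∀ x, PVal T w x → phi T w x = c →
      ∃ p o', RR (comb (colEnd T) (startC T w) (confGr T w)) x p o' := by
  induction h with
  | refl c =>
    rintro (⟨q, m⟩ | q) hx rfl
    · simp only [phi, PVal] at hx hc'
      omega
    · simp only [phi] at hc'
      exact ⟨q, _, RR.exit (by simp [comb, colEnd, hc'.1])⟩
  | @stepL q m q' v u cf ht hm _ ih =>
    rintro (⟨q1, m1⟩ | q1) hx he
    · simp only [phi, Prod.mk.injEq] at he
      obtain ⟨rfl, rfl⟩ := he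
      simp only [PVal] at hx
      obtain ⟨p, o', hr⟩ := ih hc' (Sum.inl (q', m1 - 1)) (by simp only [PVal]; omega) rfl
      refine ⟨p, _, RR.step (v' := Sum.inl (q', m1 - 1)) ?_ hr⟩
      simp [comb, confGr, hx, ht, show m1 ≠ 0 by omega]
    · simp only [phi, Prod.mk.injEq] at he
      obtain ⟨rfl, rfl⟩ := he
      by_cases hf : q1 ∈ T.final
      · exact ⟨q1, _, RR.exit (by simp [comb, colEnd, hf])⟩
      obtain ⟨p, o', hr⟩ := ih hc' (Sum.inl (q', w.length)) (by simp only [PVal]; omega) rfl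
      rw [tapeAt_end] at ht
      refine ⟨p, _, RR.step (v' := Sum.inl (q', w.length)) ?_ hr⟩
      simp [comb, colEnd, hf, ht, startC]
  | @stepR q m q' v u cf ht hm _ ih =>
    rintro (⟨q1, m1⟩ | q1) hx he
    · simp only [phi, Prod.mk.injEq] at he
      obtain ⟨rfl, rfl⟩ := he
      simp only [PVal] at hx
      by_cases hlt : m1 < w.length
      · obtain ⟨p, o', hr⟩ := ih hc' (Sum.inl (q', m1 + 1)) (by simp only [PVal]; omega) rfl
        refine ⟨p, _, RR.step (v' := Sum.inl (q', m1 + 1)) ?_ hr⟩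
        simp [comb, confGr, hx, ht, hlt]
      · have : m1 = w.length := by omega
        subst this
        obtain ⟨p, o', hr⟩ := ih hc' (Sum.inr q') trivial rfl
        refine ⟨p, _, RR.step (v' := Sum.inr q') ?_ hr⟩
        simp [comb, confGr, ht]
    · simp only [phi, Prod.mk.injEq] at he
      omega

abbrev NN : ℕ := 2 * Fintype.card (Option T.Q)

abbrev Shape : Type := (Option T.Q → Fin (NN T)) × (Fin (NN T) → Option (Fin (NN T) ⊕ T.Q))

/-- Columns with symbolic output. -/
def symCol {Q B X : Type} (col : Q → Option ((Q ⊕ Q) × List B)) (q : Q) :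
    Option ((Q ⊕ Q) × List (B ⊕ X)) :=
  (col q).map fun y => (y.1, y.2.map Sum.inl)

/-- Symbolic graph of a shape extended with a column. -/
def symGr (s : Shape T) (col : T.Q → Option ((T.Q ⊕ T.Q) × List B)) :
    Gr (Fin (NN T) ⊕ T.Q) T.Q (B ⊕ Fin (NN T)) :=
  comb (symCol col) s.1 ⟨s.2, fun v => [Sum.inr v]⟩

theorem occ_map_inl {X : Type} (x : X) (l : List B) :
    occCount x (l.map (Sum.inl : B → B ⊕ X)) = 0 := by
  simp [occCount]

theorem symGr_copyless (s : Shape T) (col : T.Q → Option ((T.Q ⊕ T.Q) × List B)) (z) :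
    ∑ x, occCount z ((symGr T s col).lab x) ≤ 1 := by
  rw [Fintype.sum_sum_type]
  have h1 : ∑ q : T.Q, occCount z ((symGr T s col).lab (Sum.inr q)) = 0 := by
    apply Finset.sum_eq_zero
    intro q _
    simp only [symGr, comb, symCol]
    cases col q with
    | none => simp [occCount]
    | some y => simp [occ_map_inl]
  have h2 : ∑ v, occCount z ((symGr T s col).lab (Sum.inl v)) = ∑ v, if v = z then 1 else 0 := by
    apply Finset.sum_congr rfl
    intro v _
    simp only [symGr, comb, occCount, List.countP_singleton]
    simp
  rw [h1, h2]
  simp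

theorem symGr_ev (s : Shape T) (col : T.Q → Option ((T.Q ⊕ T.Q) × List B))
    (val : Fin (NN T) → List B) :
    (symGr T s col).ev val = comb col s.1 ⟨s.2, val⟩ := by
  unfold Gr.ev symGr comb
  congr 1
  · funext x
    rcases x with v | q
    · rfl
    · simp only [symCol]
      cases col q <;> rfl
  · funext x
    rcases x with v | q
    · simp [evalSubst]
    · simp only [symCol]
      cases col q with
      | none => rfl
      | some y => simp [evalSubst_map_inl]

theorem baseSym_copyless (z : Empty) :
    ∑ x, occCount z ((⟨(baseGr T).next, fun q => ((baseGr T).lab q).map Sum.inl⟩ :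
      Gr T.Q T.Q (B ⊕ Empty)).lab x) ≤ 1 := z.elim

theorem exists_base : ∃ (s : Shape T) (val : Fin (NN T) → List B),
    ∀ e p o, RR (⟨s.2, val⟩ : Gr _ _ _) (s.1 e) p o ↔ RR (confGr T []) (startC T [] e) p o := by
  obtain ⟨ent, G, _, h⟩ := exists_small (baseEnt T) _ (baseSym_copyless T)
  refine ⟨(ent, G.next), fun v => evalSubst (fun e : Empty => e.elim) (G.lab v), ?_⟩
  intro e p o
  rw [← base_iff]
  have h1 := ev_iff G (fun e : Empty => e.elim) (ent e) p o
  have h2 := ev_iff (⟨(baseGr T).next, fun q => ((baseGr T).lab q).map Sum.inl⟩ :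
      Gr T.Q T.Q (B ⊕ Empty)) (fun e : Empty => e.elim) (baseEnt T e) p o
  have h3 : (⟨(baseGr T).next, fun q => ((baseGr T).lab q).map Sum.inl⟩ :
      Gr T.Q T.Q (B ⊕ Empty)).ev (fun e : Empty => e.elim) = baseGr T := by
    simp [Gr.ev, evalSubst_map_inl]
  rw [h3] at h2
  rw [h2]
  refine Iff.trans h1 ?_
  simp only [← h e p]

noncomputable def stepS (s : Shape T) (a : A) :
    Shape T × (Fin (NN T) → List (B ⊕ Fin (NN T))) :=
  let h := exists_small (entComb s.1) _ (symGr_copyless T s (colT T (TapeSym.letter a)))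
  ((h.choose, h.choose_spec.choose.next), h.choose_spec.choose.lab)

theorem stepS_copyless (s : Shape T) (a : A) (z) :
    ∑ x, occCount z ((stepS T s a).2 x) ≤ 1 :=
  (exists_small (entComb s.1) _
    (symGr_copyless T s (colT T (TapeSym.letter a)))).choose_spec.choose_spec.1 z

theorem stepS_spec (s : Shape T) (a : A) (e p o) :
    RR (symGr T s (colT T (TapeSym.letter a))) (entComb s.1 e) p o ↔
    RR (⟨(stepS T s a).1.2, (stepS T s a).2⟩ : Gr _ _ _) ((stepS T s a).1.1 e) p o :=
  (exists_small (entComb s.1) _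
    (symGr_copyless T s (colT T (TapeSym.letter a)))).choose_spec.choose_spec.2 e p o

noncomputable def outS (s : Shape T) : Option (List (B ⊕ Fin (NN T))) :=
  if h : ∃ o p, RR (symGr T s (colEnd T)) (Sum.inl (s.1 none)) p o then some h.choose else none

noncomputable def toSST : SST A B where
  Q := Shape T
  X := Fin (NN T)
  finQ := Fintype.ofFinite _
  q0 := (exists_base T).choose
  init := (exists_base T).choose_spec.choose
  trans s a := some (stepS T s a)
  out := outS T

def Inv (u : List A) (s : Shape T) (val : Fin (NN T) → List B) : Prop :=
  ∀ e p o, RR (⟨s.2, val⟩ : Gr _ _ _) (s.1 e) p o ↔ RR (confGr T u) (startC T u e) p o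

theorem comb_iff (u : List A) (s : Shape T) (val : Fin (NN T) → List B) (h : Inv T u s val)
    (col : T.Q → Option ((T.Q ⊕ T.Q) × List B)) (e p o) :
    (∃ o', RR (symGr T s col) (entComb s.1 e) p o' ∧ evalSubst val o' = o) ↔
    RR (comb col (startC T u) (confGr T u)) (entComb (startC T u) e) p o := by
  rw [← ev_iff, symGr_ev]
  exact ⟨comb_fwd (fun e p o => (h e p o).1) e p o, comb_fwd (fun e p o => (h e p o).2) e p o⟩

theorem Inv_step (u : List A) (s : Shape T) (val : Fin (NN T) → List B) (h : Inv T u s val)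
    (a : A) : Inv T (u ++ [a]) (stepS T s a).1
      (fun x => evalSubst val ((stepS T s a).2 x)) := by
  intro e p o
  rw [← conf_snoc, ← comb_iff T u s val h]
  simp only [stepS_spec]
  exact ev_iff _ val _ _ _

theorem run_inv (w : List A) : ∀ (u : List A) (s : Shape T) (val : Fin (NN T) → List B),
    Inv T u s val → ∃ s' val', (toSST T).runFrom s val w = some (s', val') ∧
      Inv T (u ++ w) s' val' := by
  induction w with
  | nil =>
    intro u s val h
    exact ⟨s, val, rfl, by simpa using h⟩
  | cons a w ih =>
    intro u s val h
    obtain ⟨s', val', h1, h2⟩ := ih _ _ _ (Inv_step T u s val h a)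
    exact ⟨s', val', h1, by simpa using h2⟩

theorem toSST_computes (f : List A → Option (List B)) (hf : T.Computes f) :
    (toSST T).Computes f := by
  intro w
  obtain ⟨s, val, h1, h2⟩ := run_inv T w [] (toSST T).q0 (toSST T).init
    (exists_base T).choose_spec.choose_spec
  have hev : (toSST T).eval w = (outS T s).map fun o => evalSubst val o := by
    unfold SST.eval
    rw [h1]
    rfl
  rw [hev]
  simp only [List.nil_append] at h2
  have hfw : ∀ v, (outS T s).map (fun o => evalSubst val o) = some v → f w = some v := by
    intro v hv
    unfold outS at hv
    split at hv
    · rename_i h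
      obtain ⟨p, hp⟩ := h.choose_spec
      have hv := Option.some.inj hv
      obtain ⟨n, h3⟩ := (comb_iff T w s val h2 (colEnd T) none p v).1 ⟨_, hp, hv⟩
      obtain ⟨h4, h5⟩ := end_fwd T w h3 (by simp [entComb, PVal, startC])
      exact (hf w v).2 ⟨p, h4, h5⟩
    · cases hv
  cases hfv : f w with
  | none =>
    cases hv : (outS T s).map (fun o => evalSubst val o) with
    | none => rfl
    | some v => rw [hfw v hv] at hfv; simp at hfv
  | some v =>
    obtain ⟨q, hq, hs⟩ := (hf w v).1 hfv
    obtain ⟨p, o, h3⟩ := end_bwd T w hs ⟨hq, rfl⟩ (Sum.inl (T.q0, 0)) (by simp [PVal]) rfl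
    obtain ⟨o', h4, _⟩ := (comb_iff T w s val h2 (colEnd T) none p o).2 h3
    have h5 : ∃ o p, RR (symGr T s (colEnd T)) (Sum.inl (s.1 none)) p o := ⟨o', p, h4⟩
    have h6 : (outS T s).map (fun o => evalSubst val o) = some (evalSubst val h5.choose) := by
      unfold outS
      rw [dif_pos h5]
      rfl
    rw [h6, ← hfv]
    exact (hfw _ h6).symm

theorem toSST_copyless : (toSST T).Copyless := by
  intro s a p hp x
  have : stepS T s a = p := Option.some.inj hp
  subst this
  exact stepS_copyless T s a x

end ToSST

/-! ### Runs of two-way transducers -/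

theorem Steps.trans {A B : Type} {T : TwoWayT A B} {w : List A} {c c' c'' : T.Q × ℕ}
    {u v : List B} (h : TwoWayT.Steps T w c u c') (h2 : TwoWayT.Steps T w c' v c'') :
    TwoWayT.Steps T w c (u ++ v) c'' := by
  induction h with
  | refl c => exact h2
  | stepL ht hm _ ih =>
    rw [List.append_assoc]
    exact TwoWayT.Steps.stepL ht hm (ih h2)
  | stepR ht hm _ ih =>
    rw [List.append_assoc]
    exact TwoWayT.Steps.stepR ht hm (ih h2)

theorem Steps.oneL {A B : Type} {T : TwoWayT A B} {w : List A} {q q' : T.Q} {m : ℕ}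
    {v : List B} (h : T.trans q (tapeAt w m) = some ((q', Dir.left), v)) (hm : 1 ≤ m) :
    TwoWayT.Steps T w (q, m) v (q', m - 1) := by
  have := TwoWayT.Steps.stepL h hm (TwoWayT.Steps.refl _)
  simpa using this

theorem Steps.oneR {A B : Type} {T : TwoWayT A B} {w : List A} {q q' : T.Q} {m : ℕ}
    {v : List B} (h : T.trans q (tapeAt w m) = some ((q', Dir.right), v)) (hm : m ≤ w.length) :
    TwoWayT.Steps T w (q, m) v (q', m + 1) := by
  have := TwoWayT.Steps.stepR h hm (TwoWayT.Steps.refl _)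
  simpa using this

theorem Steps.det {A B : Type} {T : TwoWayT A B} {w : List A} {c c1 c2 : T.Q × ℕ}
    {u v : List B} (h : TwoWayT.Steps T w c u c1) (h2 : TwoWayT.Steps T w c v c2)
    (s1 : T.trans c1.1 (tapeAt w c1.2) = none) (s2 : T.trans c2.1 (tapeAt w c2.2) = none) :
    u = v ∧ c1 = c2 := by
  induction h generalizing v with
  | refl c =>
    cases h2 with
    | refl => exact ⟨rfl, rfl⟩
    | stepL ht _ _ => simp [ht] at s1
    | stepR ht _ _ => simp [ht] at s1
  | stepL ht hm _ ih =>
    cases h2 with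
    | refl => simp [ht] at s2
    | stepL ht' hm' h2 =>
      rw [ht] at ht'
      simp at ht'
      obtain ⟨rfl, rfl⟩ := ht'
      obtain ⟨rfl, h⟩ := ih h2 s1
      exact ⟨rfl, h⟩
    | stepR ht' hm' h2 => rw [ht] at ht'; simp at ht'
  | stepR ht hm _ ih =>
    cases h2 with
    | refl => simp [ht] at s2
    | stepL ht' hm' h2 => rw [ht] at ht'; simp at ht'
    | stepR ht' hm' h2 =>
      rw [ht] at ht'
      simp at ht'
      obtain ⟨rfl, rfl⟩ := ht'
      obtain ⟨rfl, h⟩ := ih h2 s1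
      exact ⟨rfl, h⟩

/-! ### Removing the look-behind -/

inductive HU (S R : Type) where
  | run (s : S) (r : R)
  | back0 (s : S) (r : R)
  | back (s : S) (g : R → Option R)
  | forth (s : S) (p1 p2 : R)
  | bounce (s : S) (r : R)

def HU.code {S R : Type} : HU S R → S × (R ⊕ R ⊕ (R → Option R) ⊕ (R × R) ⊕ R)
  | run s r => (s, Sum.inl r)
  | back0 s r => (s, Sum.inr (Sum.inl r))
  | back s g => (s, Sum.inr (Sum.inr (Sum.inl g)))
  | forth s p1 p2 => (s, Sum.inr (Sum.inr (Sum.inr (Sum.inl (p1, p2)))))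
  | bounce s r => (s, Sum.inr (Sum.inr (Sum.inr (Sum.inr r))))

theorem HU.finite (S R : Type) [Finite S] [Finite R] : Finite (HU S R) := by
  apply Finite.of_injective (HU.code (S := S) (R := R))
  intro a b h
  cases a <;> cases b <;> simp_all [HU.code]

section LookBehind

variable {A B S R : Type} (tr : S → R → TapeSym A → Option ((S × Dir) × List B))
  (δ : R → TapeSym A → Option R)

def IsSing (g : R → Option R) (r0 : R) : Prop :=
  (∃ x, g x = some r0) ∧ ∀ x y, g x = some y → y = r0

noncomputable def gInit (r : R) (t : TapeSym A) : R → Option R :=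
  fun x => if δ x t = some r then some x else none

def gStep (g : R → Option R) (t : TapeSym A) : R → Option R :=
  fun x => (δ x t).bind g

noncomputable def huTrans : HU S R → TapeSym A → Option ((HU S R × Dir) × List B)
  | HU.run s r, t => match tr s r t with
    | none => none
    | some ((s', Dir.left), v) => some ((HU.back0 s' r, Dir.left), v)
    | some ((s', Dir.right), v) => (δ r t).map fun r' => ((HU.run s' r', Dir.right), v)
  | HU.back0 s r, t =>
    if h : ∃ r0, IsSing (gInit δ r t) r0 then some ((HU.bounce s h.choose, Dir.right), [])
    else some ((HU.back s (gInit δ r t), Dir.left), [])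
  | HU.back s g, t =>
    if h : ∃ r0, IsSing (gStep δ g t) r0 then
      if h2 : ∃ x : R × R, ∃ y, g x.1 = some h.choose ∧ g x.2 = some y ∧ y ≠ h.choose then
        some ((HU.forth s h2.choose.1 h2.choose.2, Dir.right), [])
      else none
    else some ((HU.back s (gStep δ g t), Dir.left), [])
  | HU.forth s p1 p2, t => match δ p1 t, δ p2 t with
    | some a, some b => if a = b then some ((HU.bounce s p1, Dir.right), [])
      else some ((HU.forth s a b, Dir.right), [])
    | _, _ => none
  | HU.bounce s r, _ => some ((HU.run s r, Dir.left), [])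

noncomputable def huT [Finite S] [Finite R] (s0 : S) (r0 : R) (fin : Set S) : TwoWayT A B where
  Q := HU S R
  finQ := @Fintype.ofFinite _ (HU.finite S R)
  q0 := HU.run s0 r0
  final := {x | ∃ s ∈ fin, ∃ r, x = HU.run s r}
  trans := huTrans tr δ

variable [Finite S] [Finite R] (s0 : S) (fin : Set S) (w : List A) (r : ℕ → R)

theorem IsSing.unique {g : R → Option R} {a b : R} {x : R} (h : IsSing g a) (hx : g x = some b) :
    a = b := (h.2 x b hx).symm

noncomputable def gA (k : ℕ) : ℕ → R → Option R
  | 0 => gInit δ (r (k + 1)) (tapeAt w k)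
  | d + 1 => gStep δ (gA k d) (tapeAt w (k - (d + 1)))

theorem gA_main
    (hr : ∀ j ≤ w.length, δ (r j) (tapeAt w j) = some (r (j + 1)))
    (k : ℕ) (hk : k ≤ w.length) (d : ℕ) (hd : d ≤ k) :
    gA δ w r k d (r (k - d)) = some (r k) := by
  induction d with
  | zero => simp [gA, gInit, hr k hk]
  | succ d ih =>
    simp only [gA, gStep]
    rw [hr _ (by omega)]
    have : k - (d + 1) + 1 = k - d := by omega
    rw [this]
    exact ih (by omega)

theorem forth_steps (k : ℕ) (hk : k ≤ w.length) (s : S) (d : ℕ) (hd : d ≤ k) :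
    ∀ p1 p2 y, gA δ w r k d p1 = some (r k) → gA δ w r k d p2 = some y → y ≠ r k →
    TwoWayT.Steps (huT tr δ s0 (r 0) fin) w (HU.forth s p1 p2, k - d) []
      (HU.bounce s (r k), k + 1) := by
  induction d with
  | zero =>
    intro p1 p2 y h1 h2 hy
    simp only [gA, gInit, Option.ite_none_right_eq_some, Option.some.injEq] at h1 h2
    obtain ⟨h1, rfl⟩ := h1
    obtain ⟨h2, rfl⟩ := h2
    refine Steps.oneR ?_ (by omega)
    simp [huT, huTrans, h1, h2]
  | succ d ih =>
    intro p1 p2 y h1 h2 hy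
    simp only [gA, gStep, Option.bind_eq_some_iff] at h1 h2
    obtain ⟨a, h1, h1'⟩ := h1
    obtain ⟨b, h2, h2'⟩ := h2
    have hab : a ≠ b := by
      rintro rfl
      rw [h1'] at h2'
      exact hy (Option.some.inj h2').symm
    have := ih (by omega) a b y h1' h2' hy
    have h3 : TwoWayT.Steps (huT tr δ s0 (r 0) fin) w (HU.forth s p1 p2, k - (d + 1)) []
      (HU.forth s a b, k - (d + 1) + 1) := by
      refine Steps.oneR ?_ (by omega)
      simp [huT, huTrans, h1, h2, hab]
    rw [show k - (d + 1) + 1 = k - d by omega] at h3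
    exact Steps.trans h3 this

theorem back_steps
    (hr : ∀ j ≤ w.length, δ (r j) (tapeAt w j) = some (r (j + 1)))
    (hl : ∀ x y, δ x TapeSym.lend = some y → x = r 0)
    (k : ℕ) (hk : k ≤ w.length) (s : S) (j : ℕ) :
    ∀ d, j + d + 1 = k → (¬ ∃ r0, IsSing (gA δ w r k d) r0) →
    TwoWayT.Steps (huT tr δ s0 (r 0) fin) w (HU.back s (gA δ w r k d), j) []
      (HU.bounce s (r k), k + 1) := by
  induction j with
  | zero =>
    intro d hd hns
    have hg : gStep δ (gA δ w r k d) (tapeAt w 0) = gA δ w r k (d + 1) := by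
      simp only [gA, show k - (d + 1) = 0 by omega]
    have hm := gA_main δ w r hr k hk (d + 1) (by omega)
    rw [show k - (d + 1) = 0 by omega] at hm
    have hs : ∃ r0, IsSing (gA δ w r k (d + 1)) r0 := by
      refine ⟨r k, ⟨_, hm⟩, ?_⟩
      intro x y hx
      have hx' := hx
      rw [← hg] at hx'
      simp only [gStep, Option.bind_eq_some_iff] at hx'
      obtain ⟨a, ha, _⟩ := hx'
      have : x = r 0 := hl x a (by simpa [tapeAt] using ha)
      subst this
      rw [hm] at hx
      exact (Option.some.inj hx).symm
    have hch : hs.choose = r k := hs.choose_spec.unique hm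
    have hm' := gA_main δ w r hr k hk d (by omega)
    have h2 : ∃ x : R × R, ∃ y, gA δ w r k d x.1 = some hs.choose ∧
        gA δ w r k d x.2 = some y ∧ y ≠ hs.choose := by
      by_contra hcon
      push Not at hcon
      apply hns
      refine ⟨r k, ⟨_, hm'⟩, fun x y hx => ?_⟩
      rw [hcon (r (k - d), x) y (by rw [hch]; exact hm') hx, hch]
    obtain ⟨y, b1, b2, b3⟩ := h2.choose_spec
    have c1 := b1.trans (congrArg some hch)
    have c3 : y ≠ r k := fun h => b3 (h.trans hch.symm)
    have h3 := forth_steps tr δ s0 fin w r k hk s d (by omega) _ _ y c1 b2 c3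
    have h4 : TwoWayT.Steps (huT tr δ s0 (r 0) fin) w (HU.back s (gA δ w r k d), 0) []
        (HU.forth s h2.choose.1 h2.choose.2, 0 + 1) := by
      refine Steps.oneR ?_ (by omega)
      simp only [huT, huTrans, hg]
      rw [dif_pos hs, dif_pos h2]
    rw [show 0 + 1 = k - d by omega] at h4
    exact Steps.trans h4 h3
  | succ j ih =>
    intro d hd hns
    have hg : gStep δ (gA δ w r k d) (tapeAt w (j + 1)) = gA δ w r k (d + 1) := by
      simp only [gA, show k - (d + 1) = j + 1 by omega]
    have hm := gA_main δ w r hr k hk (d + 1) (by omega)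
    by_cases hs : ∃ r0, IsSing (gA δ w r k (d + 1)) r0
    · have hch : hs.choose = r k := hs.choose_spec.unique hm
      have hm' := gA_main δ w r hr k hk d (by omega)
      have h2 : ∃ x : R × R, ∃ y, gA δ w r k d x.1 = some hs.choose ∧
          gA δ w r k d x.2 = some y ∧ y ≠ hs.choose := by
        by_contra hcon
        push Not at hcon
        apply hns
        refine ⟨r k, ⟨_, hm'⟩, fun x y hx => ?_⟩
        rw [hcon (r (k - d), x) y (by rw [hch]; exact hm') hx, hch]
      obtain ⟨y, b1, b2, b3⟩ := h2.choose_spec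
      have c1 := b1.trans (congrArg some hch)
      have c3 : y ≠ r k := fun h => b3 (h.trans hch.symm)
      have h3 := forth_steps tr δ s0 fin w r k hk s d (by omega) _ _ y c1 b2 c3
      have h4 : TwoWayT.Steps (huT tr δ s0 (r 0) fin) w (HU.back s (gA δ w r k d), j + 1) []
          (HU.forth s h2.choose.1 h2.choose.2, j + 1 + 1) := by
        refine Steps.oneR ?_ (by omega)
        simp only [huT, huTrans, hg]
        rw [dif_pos hs, dif_pos h2]
      rw [show j + 1 + 1 = k - d by omega] at h4
      exact Steps.trans h4 h3
    · have h4 : TwoWayT.Steps (huT tr δ s0 (r 0) fin) w (HU.back s (gA δ w r k d), j + 1) []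
          (HU.back s (gA δ w r k (d + 1)), j + 1 - 1) := by
        refine Steps.oneL ?_ (by omega)
        simp only [huT, huTrans, hg]
        rw [dif_neg hs]
      exact Steps.trans h4 (ih (d + 1) (by omega) hs)

theorem bigStepL
    (hr : ∀ j ≤ w.length, δ (r j) (tapeAt w j) = some (r (j + 1)))
    (hl : ∀ x y, δ x TapeSym.lend = some y → x = r 0)
    (m : ℕ) (hm : m ≤ w.length) (s s' : S) (v : List B)
    (h : tr s (r (m + 1)) (tapeAt w (m + 1)) = some ((s', Dir.left), v)) :
    TwoWayT.Steps (huT tr δ s0 (r 0) fin) w (HU.run s (r (m + 1)), m + 1) v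
      (HU.run s' (r m), m) := by
  have h1 : TwoWayT.Steps (huT tr δ s0 (r 0) fin) w (HU.run s (r (m + 1)), m + 1) v
      (HU.back0 s' (r (m + 1)), m + 1 - 1) := by
    refine Steps.oneL ?_ (by omega)
    simp [huT, huTrans, h]
  have h3 : TwoWayT.Steps (huT tr δ s0 (r 0) fin) w (HU.bounce s' (r m), m + 1) []
      (HU.run s' (r m), m + 1 - 1) := by
    refine Steps.oneL ?_ (by omega)
    simp [huT, huTrans]
  have hmain := gA_main δ w r hr m hm 0 (by omega)
  have h2 : TwoWayT.Steps (huT tr δ s0 (r 0) fin) w (HU.back0 s' (r (m + 1)), m) []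
      (HU.bounce s' (r m), m + 1) := by
    by_cases hs : ∃ r0, IsSing (gA δ w r m 0) r0
    · have hch : hs.choose = r m := hs.choose_spec.unique hmain
      refine Steps.oneR ?_ (by omega)
      have hs' : ∃ r0, IsSing (gInit δ (r (m + 1)) (tapeAt w m)) r0 := hs
      simp only [huT, huTrans]
      rw [dif_pos hs']
      change some ((HU.bounce s' hs.choose, Dir.right), []) = _
      rw [hch]
    · cases m with
      | zero =>
        exfalso
        apply hs
        refine ⟨r 0, ⟨_, hmain⟩, ?_⟩
        intro x y hx
        simp only [gA, gInit, Option.ite_none_right_eq_some, Option.some.injEq] at hx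
        obtain ⟨hx, rfl⟩ := hx
        exact hl x _ (by simpa [tapeAt] using hx)
      | succ j =>
        have h4 : TwoWayT.Steps (huT tr δ s0 (r 0) fin) w
            (HU.back0 s' (r (j + 1 + 1)), j + 1) [] (HU.back s' (gA δ w r (j + 1) 0), j + 1 - 1) := by
          refine Steps.oneL ?_ (by omega)
          have hs' : ¬ ∃ r0, IsSing (gInit δ (r (j + 1 + 1)) (tapeAt w (j + 1))) r0 := hs
          simp only [huT, huTrans]
          rw [dif_neg hs']
          rfl
        exact Steps.trans h4
          (back_steps tr δ s0 fin w r hr hl (j + 1) hm s' j 0 (by omega) hs)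
  have := Steps.trans h1 (Steps.trans h2 h3)
  simpa using this

theorem bigStepR
    (hr : ∀ j ≤ w.length, δ (r j) (tapeAt w j) = some (r (j + 1)))
    (m : ℕ) (hm : m ≤ w.length) (s s' : S) (v : List B)
    (h : tr s (r m) (tapeAt w m) = some ((s', Dir.right), v)) :
    TwoWayT.Steps (huT tr δ s0 (r 0) fin) w (HU.run s (r m), m) v
      (HU.run s' (r (m + 1)), m + 1) := by
  refine Steps.oneR ?_ hm
  simp [huT, huTrans, h, hr m hm]

end LookBehind

/-! ### From copyless SSTs to two-way transducers -/

section Backward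

variable {A B : Type} (T : SST A B)

def LS : Type := {l : List (B ⊕ T.X) // ∃ q o, T.out q = some o ∧ l <:+ o}

theorem LS.finite : Finite (LS T) := by
  have : ({l | ∃ q o, T.out q = some o ∧ l <:+ o} : Set (List (B ⊕ T.X))).Finite := by
    have h2 : ({l | ∃ q o, T.out q = some o ∧ l <:+ o} : Set (List (B ⊕ T.X))) =
        ⋃ q : T.Q, {l | l ∈ ((T.out q).map List.tails).getD []} := by
      ext l
      simp only [Set.mem_setOf_eq, Set.mem_iUnion]
      refine exists_congr fun q => ?_
      cases T.out q <;> simp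
    rw [h2]
    exact Set.finite_iUnion fun q => List.finite_toSet _
  exact this.to_subtype

inductive SS where
  | fwd
  | down (x : T.X) (l : LS T)
  | up (x : T.X) (l : LS T)
  | fin
  | acc

def SS.code : SS T → (T.X × LS T) ⊕ (T.X × LS T) ⊕ Fin 3
  | fwd => Sum.inr (Sum.inr 0)
  | down x l => Sum.inl (x, l)
  | up x l => Sum.inr (Sum.inl (x, l))
  | fin => Sum.inr (Sum.inr 1)
  | acc => Sum.inr (Sum.inr 2)

theorem SS.finite : Finite (SS T) := by
  haveI := LS.finite T
  apply Finite.of_injective (SS.code T)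
  intro a b h
  cases a <;> cases b <;> simp_all [SS.code]

def scan {S X : Type} (onReg : X → List (B ⊕ X) → Option (S × Dir)) (onEnd : S × Dir) :
    List B → List (B ⊕ X) → Option ((S × Dir) × List B)
  | u, [] => some (onEnd, u)
  | u, Sum.inl b :: l => scan onReg onEnd (u ++ [b]) l
  | u, Sum.inr x :: l => (onReg x l).map fun s => (s, u)

def scanL (x : T.X) (l : LS T) : List B → List (B ⊕ T.X) → Option ((SS T × Dir) × List B) :=
  scan (fun z _ => some (SS.down z l, Dir.left)) (SS.up x l, Dir.right)

noncomputable def scanEnd : List B → List (B ⊕ T.X) → Option ((SS T × Dir) × List B) :=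
  scan (fun z rest => if h : ∃ q o, T.out q = some o ∧ rest <:+ o then
    some (SS.down z ⟨rest, h⟩, Dir.left) else none) (SS.fin, Dir.left)

def δS : Option (Option T.Q) → TapeSym A → Option (Option (Option T.Q))
  | none, TapeSym.lend => some (some (some T.q0))
  | some s, TapeSym.letter a => some (some (s.bind fun q => (T.trans q a).map Prod.fst))
  | _, _ => none

noncomputable def trS : SS T → Option (Option T.Q) → TapeSym A →
    Option ((SS T × Dir) × List B)
  | SS.fwd, _, TapeSym.lend => some ((SS.fwd, Dir.right), [])
  | SS.fwd, _, TapeSym.letter _ => some ((SS.fwd, Dir.right), [])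
  | SS.fwd, some (some q), TapeSym.rend => (T.out q).bind (scanEnd T [])
  | SS.down y l, _, TapeSym.lend => some ((SS.up y l, Dir.right), T.init y)
  | SS.down y l, some (some q), TapeSym.letter a =>
      (T.trans q a).bind fun p => scanL T y l [] (p.2 y)
  | SS.up y l, some (some q), TapeSym.letter a =>
      (T.trans q a).bind fun p =>
        if h : ∃ z : T.X × List (B ⊕ T.X) × List (B ⊕ T.X),
            p.2 z.1 = z.2.1 ++ Sum.inr y :: z.2.2 then
          scanL T h.choose.1 l [] h.choose.2.2 else none
  | SS.up _ l, _, TapeSym.rend => scanEnd T [] l.1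
  | SS.fin, _, _ => some ((SS.acc, Dir.right), [])
  | _, _, _ => none

theorem runFrom_snoc (q : T.Q) (v : T.X → List B) (u : List A) (a : A) :
    T.runFrom q v (u ++ [a]) = (T.runFrom q v u).bind fun c =>
      (T.trans c.1 a).map fun p => (p.1, fun x => evalSubst c.2 (p.2 x)) := by
  induction u generalizing q v with
  | nil =>
    simp only [List.nil_append, SST.runFrom, Option.bind_some]
    cases T.trans q a <;> simp
  | cons b u ih =>
    simp only [List.cons_append, SST.runFrom]
    cases T.trans q b with
    | none => simp
    | some p => simp only [ih]

theorem occ_pos {X : Type} (y : X) (l1 l2 : List (B ⊕ X)) :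
    occCount y (l1 ++ Sum.inr y :: l2) = occCount y l1 + occCount y l2 + 1 := by
  simp [occCount]
  omega

theorem occ_eq_unique {X : Type} (y : X) (l1 l2 k1 k2 : List (B ⊕ X))
    (h : l1 ++ Sum.inr y :: l2 = k1 ++ Sum.inr y :: k2)
    (h1 : occCount y (l1 ++ Sum.inr y :: l2) ≤ 1) : l1 = k1 ∧ l2 = k2 := by
  induction l1 generalizing k1 with
  | nil =>
    cases k1 with
    | nil => simpa using h
    | cons c k1 =>
      exfalso
      simp only [List.nil_append, List.cons_append, List.cons.injEq] at h
      obtain ⟨rfl, rfl⟩ := h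
      simp [occCount] at h1
  | cons c l1 ih =>
    cases k1 with
    | nil =>
      exfalso
      simp only [List.nil_append, List.cons_append, List.cons.injEq] at h
      obtain ⟨rfl, rfl⟩ := h
      simp [occCount] at h1
    | cons d k1 =>
      simp only [List.cons_append, List.cons.injEq] at h
      obtain ⟨rfl, h⟩ := h
      have h1' : occCount y (l1 ++ Sum.inr y :: l2) ≤ 1 := by
        refine le_trans ?_ h1
        simp only [occCount, List.cons_append]
        rw [List.countP_cons]
        exact Nat.le_add_right _ _
      obtain ⟨rfl, rfl⟩ := ih k1 h h1'
      exact ⟨rfl, rfl⟩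

theorem copyless_unique {X : Type} [Fintype X] (σ : X → List (B ⊕ X)) (y : X)
    (hσ : totalOcc σ y ≤ 1) (x x' : X) (l1 l2 k1 k2 : List (B ⊕ X))
    (h : σ x = l1 ++ Sum.inr y :: l2) (h' : σ x' = k1 ++ Sum.inr y :: k2) :
    x = x' ∧ l1 = k1 ∧ l2 = k2 := by
  have hxx : x = x' := by
    by_contra hne
    have h2 : ∑ z ∈ ({x, x'} : Finset X), occCount y (σ z) ≤ totalOcc σ y :=
      Finset.sum_le_sum_of_subset (Finset.subset_univ _)
    rw [Finset.sum_pair hne, h, h', occ_pos, occ_pos] at h2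
    omega
  subst hxx
  refine ⟨rfl, occ_eq_unique y _ _ _ _ (h.symm.trans h') ?_⟩
  rw [← h]
  refine le_trans ?_ hσ
  exact Finset.single_le_sum (f := fun z => occCount y (σ z)) (fun _ _ => Nat.zero_le _)
    (Finset.mem_univ x)

def rS (w : List A) : ℕ → Option (Option T.Q)
  | 0 => none
  | m + 1 => some ((T.runFrom T.q0 T.init (w.take m)).map Prod.fst)

theorem tapeAt_letter (w : List A) (m : ℕ) (h : m < w.length) :
    tapeAt w (m + 1) = TapeSym.letter w[m] := by
  simp [tapeAt, h]

theorem st_succ (w : List A) (m : ℕ) (h : m < w.length) :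
    T.runFrom T.q0 T.init (w.take (m + 1)) =
      (T.runFrom T.q0 T.init (w.take m)).bind fun c =>
      (T.trans c.1 w[m]).map fun p => (p.1, fun x => evalSubst c.2 (p.2 x)) := by
  rw [← runFrom_snoc, List.take_succ_eq_append_getElem h]

theorem rS_step (w : List A) (j : ℕ) (hj : j ≤ w.length) :
    δS T (rS T w j) (tapeAt w j) = some (rS T w (j + 1)) := by
  cases j with
  | zero => simp [rS, δS, tapeAt, SST.runFrom]
  | succ m =>
    rw [tapeAt_letter w m (by omega)]
    simp only [rS, δS, st_succ T w m (by omega)]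
    cases T.runFrom T.q0 T.init (w.take m) with
    | none => simp
    | some c =>
      simp only [Option.map_some, Option.bind_some]
      cases T.trans c.1 w[m] <;> simp

theorem rS_lend (w : List A) (x y : Option (Option T.Q)) (h : δS T x TapeSym.lend = some y) :
    x = rS T w 0 := by
  cases x with
  | none => rfl
  | some s => simp [δS] at h

noncomputable def toTW : TwoWayT A B :=
  haveI := SS.finite T
  huT (trS T) (δS T) SS.fwd none {SS.acc}

theorem tw_L (w : List A) (m : ℕ) (hm : m ≤ w.length) (s s' : SS T) (v : List B)
    (h : trS T s (rS T w (m + 1)) (tapeAt w (m + 1)) = some ((s', Dir.left), v)) :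
    TwoWayT.Steps (toTW T) w (HU.run s (rS T w (m + 1)), m + 1) v
      (HU.run s' (rS T w m), m) := by
  haveI := SS.finite T
  exact bigStepL (trS T) (δS T) SS.fwd {SS.acc} w (rS T w) (rS_step T w) (rS_lend T w)
    m hm s s' v h

theorem tw_R (w : List A) (m : ℕ) (hm : m ≤ w.length) (s s' : SS T) (v : List B)
    (h : trS T s (rS T w m) (tapeAt w m) = some ((s', Dir.right), v)) :
    TwoWayT.Steps (toTW T) w (HU.run s (rS T w m), m) v
      (HU.run s' (rS T w (m + 1)), m + 1) := by
  haveI := SS.finite T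
  exact bigStepR (trS T) (δS T) SS.fwd {SS.acc} w (rS T w) (rS_step T w)
    m hm s s' v h

theorem scan_steps (hc : T.Copyless) (w : List A) (m : ℕ) (hm : m < w.length)
    (c : T.Q × (T.X → List B)) (hst : T.runFrom T.q0 T.init (w.take m) = some c)
    (p : T.Q × (T.X → List (B ⊕ T.X))) (hp : T.trans c.1 w[m] = some p) (l : LS T) (x : T.X)
    (hD : ∀ y, TwoWayT.Steps (toTW T) w (HU.run (SS.down y l) (rS T w m), m) (c.2 y)
      (HU.run (SS.up y l) (rS T w (m + 1)), m + 1)) (rest : List (B ⊕ T.X)) :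
    ∀ (u : List B) (s : SS T) (pre : List (B ⊕ T.X)), p.2 x = pre ++ rest →
      trS T s (rS T w (m + 1)) (tapeAt w (m + 1)) = scanL T x l u rest →
      TwoWayT.Steps (toTW T) w (HU.run s (rS T w (m + 1)), m + 1) (u ++ evalSubst c.2 rest)
        (HU.run (SS.up x l) (rS T w (m + 2)), m + 2) := by
  induction rest with
  | nil =>
    intro u s pre hx htr
    rw [evalSubst_nil, List.append_nil]
    exact tw_R T w (m + 1) hm s _ u htr
  | cons d rest ih =>
    intro u s pre hx htr
    cases d with
    | inl b =>
      have := ih (u ++ [b]) s (pre ++ [Sum.inl b]) (by simpa using hx) htr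
      rw [evalSubst_inl]
      simpa using this
    | inr z =>
      have h1 := tw_L T w m hm.le s (SS.down z l) u (by rw [htr]; simp [scanL, scan])
      have h2 := hD z
      have hex : ∃ z' : T.X × List (B ⊕ T.X) × List (B ⊕ T.X),
            p.2 z'.1 = z'.2.1 ++ Sum.inr z :: z'.2.2 := ⟨(x, pre, rest), hx⟩
      obtain ⟨e1, e2, e3⟩ := copyless_unique p.2 z (hc _ _ _ hp z) _ _ _ _ _ _
        hex.choose_spec hx
      have h3 := ih [] (SS.up z l) (pre ++ [Sum.inr z]) (by simpa using hx) (by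
        rw [tapeAt_letter w m hm]
        simp only [rS, hst, Option.map_some, trS, hp, Option.bind_some]
        rw [dif_pos hex, e1, e3])
      have := Steps.trans h1 (Steps.trans h2 h3)
      rw [evalSubst_inr]
      simpa using this

theorem st_prev (w : List A) (m : ℕ) (hm : m < w.length) (c : T.Q × (T.X → List B))
    (h : T.runFrom T.q0 T.init (w.take (m + 1)) = some c) :
    ∃ c', T.runFrom T.q0 T.init (w.take m) = some c' ∧ ∃ p, T.trans c'.1 w[m] = some p ∧
      c = (p.1, fun x => evalSubst c'.2 (p.2 x)) := by
  rw [st_succ T w m hm, Option.bind_eq_some_iff] at h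
  obtain ⟨c', h1, h2⟩ := h
  rw [Option.map_eq_some_iff] at h2
  obtain ⟨p, hp, h3⟩ := h2
  exact ⟨c', h1, p, hp, h3.symm⟩

theorem down_steps (hc : T.Copyless) (w : List A) (l : LS T) (m : ℕ) (hm : m ≤ w.length) :
    ∀ (c : T.Q × (T.X → List B)), T.runFrom T.q0 T.init (w.take m) = some c → ∀ y,
    TwoWayT.Steps (toTW T) w (HU.run (SS.down y l) (rS T w m), m) (c.2 y)
      (HU.run (SS.up y l) (rS T w (m + 1)), m + 1) := by
  induction m with
  | zero =>
    intro c h y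
    simp only [List.take_zero, SST.runFrom, Option.some.injEq] at h
    subst h
    exact tw_R T w 0 hm _ _ _ (by simp [trS, tapeAt])
  | succ m ih =>
    intro c h y
    obtain ⟨c', hc', p, hp, rfl⟩ := st_prev T w m (by omega) c h
    have := scan_steps T hc w m (by omega) c' hc' p hp l y (ih (by omega) c' hc') (p.2 y)
      [] (SS.down y l) [] rfl (by
        rw [tapeAt_letter w m (by omega)]
        simp only [rS, hc', Option.map_some, trS, hp, Option.bind_some])
    simpa using this

theorem end_steps (hc : T.Copyless) (w : List A) (c : T.Q × (T.X → List B))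
    (hst : T.runFrom T.q0 T.init w = some c) (o : List (B ⊕ T.X))
    (ho : T.out c.1 = some o) (rest : List (B ⊕ T.X)) :
    ∀ (u : List B) (s : SS T), rest <:+ o →
      trS T s (rS T w (w.length + 1)) TapeSym.rend = scanEnd T u rest →
      TwoWayT.Steps (toTW T) w (HU.run s (rS T w (w.length + 1)), w.length + 1)
        (u ++ evalSubst c.2 rest) (HU.run SS.acc (rS T w (w.length + 1)), w.length + 1) := by
  induction rest with
  | nil =>
    intro u s hx htr
    rw [evalSubst_nil]
    have h1 := tw_L T w w.length le_rfl s SS.fin u (by rw [tapeAt_end, htr]; rfl)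
    have h2 := tw_R T w w.length le_rfl SS.fin SS.acc [] (by
      cases rS T w w.length with
      | none => cases tapeAt w w.length <;> rfl
      | some x => cases x <;> cases tapeAt w w.length <;> rfl)
    exact Steps.trans h1 h2
  | cons d rest ih =>
    intro u s hx htr
    have hx' : rest <:+ o := (List.suffix_cons d rest).trans hx
    cases d with
    | inl b =>
      have := ih (u ++ [b]) s hx' htr
      rw [evalSubst_inl]
      simpa using this
    | inr z =>
      have hl : ∃ q o, T.out q = some o ∧ rest <:+ o := ⟨_, o, ho, hx'⟩
      have h1 := tw_L T w w.length le_rfl s (SS.down z ⟨rest, hl⟩) u (by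
        rw [tapeAt_end, htr]; simp only [scanEnd, scan]; rw [dif_pos hl]; rfl)
      have h2 := down_steps T hc w ⟨rest, hl⟩ w.length le_rfl c (by simpa using hst) z
      have h3 := ih [] (SS.up z ⟨rest, hl⟩) hx' (by
        simp only [rS, List.take_length, hst, Option.map_some, trS])
      have := Steps.trans h1 (Steps.trans h2 h3)
      rw [evalSubst_inr]
      simpa using this

theorem fwd_steps (w : List A) (m : ℕ) (hm : m ≤ w.length + 1) :
    TwoWayT.Steps (toTW T) w (HU.run SS.fwd (rS T w 0), 0) []
      (HU.run SS.fwd (rS T w m), m) := by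
  induction m with
  | zero => exact TwoWayT.Steps.refl _
  | succ m ih =>
    have h := tw_R T w m (by omega) SS.fwd SS.fwd [] (by
      cases m with
      | zero => simp [tapeAt, trS]
      | succ k => rw [tapeAt_letter w k (by omega)]; simp [trS])
    exact Steps.trans (ih (by omega)) h

theorem toTW_some (hc : T.Copyless) (w : List A) (v : List B) (h : T.eval w = some v) :
    TwoWayT.Steps (toTW T) w (HU.run SS.fwd (rS T w 0), 0) v
      (HU.run SS.acc (rS T w (w.length + 1)), w.length + 1) := by
  simp only [SST.eval, Option.bind_eq_some_iff, Option.map_eq_some_iff] at h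
  obtain ⟨c, hst, o, ho, rfl⟩ := h
  have h1 := fwd_steps T w (w.length + 1) le_rfl
  have h2 := end_steps T hc w c hst o ho o [] SS.fwd List.suffix_rfl (by
    simp only [rS, List.take_length, hst, Option.map_some, trS, ho, Option.bind_some])
  simpa using Steps.trans h1 h2

theorem acc_stuck (r : Option (Option T.Q)) (t : TapeSym A) :
    (toTW T).trans (HU.run SS.acc r) t = none := by
  have h : trS T SS.acc r t = none := by
    rcases r with _ | _ | _ <;> cases t <;> rfl
  change huTrans (trS T) (δS T) (HU.run SS.acc r) t = none
  simp [huTrans, h]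

theorem fwd_stuck (w : List A) (h : T.eval w = none) :
    (toTW T).trans (HU.run SS.fwd (rS T w (w.length + 1))) (tapeAt w (w.length + 1)) = none := by
  have h : trS T SS.fwd (rS T w (w.length + 1)) (tapeAt w (w.length + 1)) = none := by
    rw [tapeAt_end]
    simp only [rS, List.take_length]
    simp only [SST.eval] at h
    cases hr : T.runFrom T.q0 T.init w with
    | none => rfl
    | some c =>
      simp only [hr, Option.bind_some, Option.map_eq_none_iff] at h
      simp only [Option.map_some, trS, h, Option.bind_none]
  change huTrans (trS T) (δS T) (HU.run SS.fwd (rS T w (w.length + 1))) _ = none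
  simp [huTrans, h]

theorem toTW_computes (hc : T.Copyless) (f : List A → Option (List B)) (hf : T.Computes f) :
    (toTW T).Computes f := by
  intro w v
  rw [← hf w]
  constructor
  · intro h
    exact ⟨HU.run SS.acc (rS T w (w.length + 1)), ⟨SS.acc, rfl, _, rfl⟩, toTW_some T hc w v h⟩
  · rintro ⟨q, ⟨s, hs, r, rfl⟩, hq⟩
    have hs' : s = SS.acc := hs
    subst hs'
    cases he : T.eval w with
    | none =>
      exfalso
      have h1 := fwd_steps T w (w.length + 1) le_rfl
      have h2 := (Steps.det hq h1 (acc_stuck T _ _) (fwd_stuck T w he)).2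
      have h3 := congrArg Prod.fst h2
      have h4 : HU.run SS.acc r = HU.run SS.fwd (rS T w (w.length + 1)) := h3
      simp at h4
    | some v' =>
      have h1 := toTW_some T hc w v' he
      have := (Steps.det hq h1 (acc_stuck T _ _) (acc_stuck T _ _)).1
      rw [this]

end Backward

end TwoWaySST

theorem stmt0 {A B : Type} [Fintype A] [Fintype B] (f : List A → Option (List B)) :
    (∃ T : TwoWayT A B, T.Computes f) ↔ (∃ S : SST A B, S.Copyless ∧ S.Computes f) := by
  exact ⟨fun ⟨T, hT⟩ => ⟨TwoWaySST.toSST T, TwoWaySST.toSST_copyless T, TwoWaySST.toSST_computes T f hT⟩,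
    fun ⟨S, hc, hS⟩ => ⟨TwoWaySST.toTW S, TwoWaySST.toTW_computes S hc f hS⟩⟩
end

section
/- Deterministic marble transducers and streaming string transducers describe the same class of functions: a partial function f : A* → B* is computable by a deterministic marble transducer if and only if it is computable by a streaming string transducer. -/
set_option autoImplicit false

/-! ### From marble transducers to SSTs -/

namespace MarbleToSST

variable {A B D : Type}

/-- Local runs at one position, using the excursion relation `E` for the positions on the left. -/
inductive Run (T : MarbleT A B) (h : List B → List D) (E : T.Q → List D → T.Q → Prop)
    (Base : T.Q → List D → T.Q → Prop) (s : TapeSym A) :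
    T.Q → Option T.C → List D → T.Q → Prop
  | base {q v q'} : Base q v q' → Run T h E Base s q none v q'
  | left {q o q1 q2 v u u' q'} : T.trans q s o = some ((q1, MAct.left), v) → E q1 u q2 →
      Run T h E Base s q2 o u' q' → Run T h E Base s q o (h v ++ (u ++ u')) q'
  | drop {q c q1 v u q'} : T.trans q s none = some ((q1, MAct.drop c), v) →
      Run T h E Base s q1 (some c) u q' → Run T h E Base s q none (h v ++ u) q'
  | lift {q c q1 v u q'} : T.trans q s (some c) = some ((q1, MAct.lift), v) →
      Run T h E Base s q1 none u q' → Run T h E Base s q (some c) (h v ++ u) q'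

def BaseR (T : MarbleT A B) (h : List B → List D) (s : TapeSym A) :
    T.Q → List D → T.Q → Prop :=
  fun q v q' => ∃ v0, T.trans q s none = some ((q', MAct.right), v0) ∧ v = h v0

def BaseF (T : MarbleT A B) (D : Type) : T.Q → List D → T.Q → Prop :=
  fun q v q' => q ∈ T.final ∧ q' = q ∧ v = []

/-- One letter extension of the excursion relation; the source `none` stands for the
initial configuration. -/
def next (T : MarbleT A B) (h : List B → List D) (Base : T.Q → List D → T.Q → Prop)
    (G : Option T.Q → List D → T.Q → Prop) (s : TapeSym A) :
    Option T.Q → List D → T.Q → Prop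
  | some q, u, q' => Run T h (fun q => G (some q)) Base s q none u q'
  | none, u, q' => ∃ q1 u1 u2, G none u1 q1 ∧
      Run T h (fun q => G (some q)) Base s q1 none u2 q' ∧ u = u1 ++ u2

def G0 (T : MarbleT A B) : Option T.Q → List B → T.Q → Prop
  | some _, _, _ => False
  | none, u, q' => u = [] ∧ q' = T.q0

def G (T : MarbleT A B) (w : List A) : ℕ → Option T.Q → List B → T.Q → Prop
  | 0 => G0 T
  | m + 1 => next T id (BaseR T id (tapeAt w m)) (G T w m) (tapeAt w m)

def Functional {X Q D : Type} (G : X → List D → Q → Prop) : Prop :=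
  ∀ x u q u' q', G x u q → G x u' q' → u = u' ∧ q = q'

theorem run_functional (T : MarbleT A B) (h : List B → List D) {E : T.Q → List D → T.Q → Prop}
    (hE : Functional E) (s : TapeSym A) {q o u q1}
    (h1 : Run T h E (BaseR T h s) s q o u q1) :
    ∀ {u' q2}, Run T h E (BaseR T h s) s q o u' q2 → u = u' ∧ q1 = q2 := by
  induction h1 with
  | base hb =>
    intro u' q2 h2
    obtain ⟨v0, hb, rfl⟩ := hb
    cases h2 with
    | base hb' => obtain ⟨v0, hb', rfl⟩ := hb'; simp_all
    | left ht => simp_all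
    | drop ht => simp_all
  | left ht he hr ih =>
    intro u' q2 h2
    cases h2 with
    | base hb' => obtain ⟨v0, hb', rfl⟩ := hb'; simp_all
    | left ht' he' hr' =>
      rw [ht] at ht'
      simp only [Option.some.injEq, Prod.mk.injEq, and_true] at ht'
      obtain ⟨rfl, rfl⟩ := ht'
      obtain ⟨rfl, rfl⟩ := hE _ _ _ _ _ he he'
      obtain ⟨rfl, rfl⟩ := ih hr'
      simp
    | drop ht' => simp_all
    | lift ht' => simp_all
  | drop ht hr ih =>
    intro u' q2 h2
    cases h2 with
    | base hb' => obtain ⟨v0, hb', rfl⟩ := hb'; simp_all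
    | left ht' => simp_all
    | drop ht' hr' =>
      rw [ht] at ht'
      simp only [Option.some.injEq, Prod.mk.injEq, MAct.drop.injEq] at ht'
      obtain ⟨⟨rfl, rfl⟩, rfl⟩ := ht'
      obtain ⟨rfl, rfl⟩ := ih hr'
      simp
  | lift ht hr ih =>
    intro u' q2 h2
    cases h2 with
    | left ht' => simp_all
    | lift ht' hr' =>
      rw [ht] at ht'
      simp only [Option.some.injEq, Prod.mk.injEq, and_true] at ht'
      obtain ⟨rfl, rfl⟩ := ht'
      obtain ⟨rfl, rfl⟩ := ih hr'
      simp

theorem next_functional (T : MarbleT A B) (h : List B → List D)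
    {G : Option T.Q → List D → T.Q → Prop}
    (hG : Functional G) (s : TapeSym A) : Functional (next T h (BaseR T h s) G s) := by
  have hE : Functional (fun q => G (some q)) := fun q u q1 u' q2 h1 h2 => hG _ _ _ _ _ h1 h2
  intro x u q u' q' h1 h2
  cases x with
  | some p => exact run_functional T h hE s h1 h2
  | none =>
    obtain ⟨q1, u1, u2, ha, hr, rfl⟩ := h1
    obtain ⟨q1', u1', u2', ha', hr', rfl⟩ := h2
    obtain ⟨rfl, rfl⟩ := hG _ _ _ _ _ ha ha'
    obtain ⟨rfl, rfl⟩ := run_functional T h hE s hr hr'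
    simp

/-- Symbolic excursion relation. -/
def Sym {X Q : Type} (B : Type) (R : X → Option Q) : X → List (B ⊕ X) → Q → Prop :=
  fun x u q' => R x = some q' ∧ u = [Sum.inr x]

def Rep {X Q : Type} (G : X → List B → Q → Prop) (R : X → Option Q) (V : X → List B) : Prop :=
  ∀ x u q, G x u q ↔ R x = some q ∧ V x = u

theorem Rep.functional {X Q : Type} {G : X → List B → Q → Prop} {R : X → Option Q}
    {V : X → List B} (h : Rep G R V) : Functional G := by
  intro x u q u' q' h1 h2
  rw [h] at h1 h2
  obtain ⟨h1, rfl⟩ := h1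
  obtain ⟨h2, rfl⟩ := h2
  simp_all

theorem eval_append {X : Type} (V : X → List B) (a b : List (B ⊕ X)) :
    evalSubst V (a ++ b) = evalSubst V a ++ evalSubst V b := by
  simp [evalSubst]

theorem eval_inl {X : Type} (V : X → List B) (a : List B) :
    evalSubst V (a.map Sum.inl) = a := by
  induction a with
  | nil => rfl
  | cons x l ih => simp_all [evalSubst]

theorem eval_reg {X : Type} (V : X → List B) (x : X) :
    evalSubst V [Sum.inr x] = V x := by
  simp [evalSubst]

/-- Two bases that agree via evaluation. -/
def BaseEq {X Q : Type} (V : X → List B) (Bs : Q → List (B ⊕ X) → Q → Prop)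
    (Bc : Q → List B → Q → Prop) : Prop :=
  ∀ q u q', Bc q u q' ↔ ∃ su, Bs q su q' ∧ evalSubst V su = u

theorem run_sym (T : MarbleT A B) {X : Type} {V : X → List B}
    {E : T.Q → List B → T.Q → Prop} {E' : T.Q → List (B ⊕ X) → T.Q → Prop}
    (hE : BaseEq V E' E) {Bs Bc} (hB : BaseEq V Bs Bc) (s : TapeSym A) (q o u q') :
    Run T id E Bc s q o u q' ↔
      ∃ su, Run T (List.map Sum.inl) E' Bs s q o su q' ∧ evalSubst V su = u := by
  constructor
  · intro h
    induction h with
    | base hb =>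
      obtain ⟨su, h1, h2⟩ := (hB _ _ _).1 hb
      exact ⟨su, .base h1, h2⟩
    | left ht he hr ih =>
      obtain ⟨su, h1, h2⟩ := (hE _ _ _).1 he
      obtain ⟨su', h1', h2'⟩ := ih
      exact ⟨_, .left ht h1 h1', by simp [eval_append, eval_inl, h2, h2']⟩
    | drop ht hr ih =>
      obtain ⟨su', h1', h2'⟩ := ih
      exact ⟨_, .drop ht h1', by simp [eval_append, eval_inl, h2']⟩
    | lift ht hr ih =>
      obtain ⟨su', h1', h2'⟩ := ih
      exact ⟨_, .lift ht h1', by simp [eval_append, eval_inl, h2']⟩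
  · rintro ⟨su, h, rfl⟩
    induction h with
    | base hb => exact .base ((hB _ _ _).2 ⟨_, hb, rfl⟩)
    | left ht he hr ih =>
      simp only [eval_append, eval_inl]
      exact .left ht ((hE _ _ _).2 ⟨_, he, rfl⟩) ih
    | drop ht hr ih =>
      simp only [eval_append, eval_inl]
      exact .drop ht ih
    | lift ht hr ih =>
      simp only [eval_append, eval_inl]
      exact .lift ht ih

theorem Rep.baseEq {X Q : Type} {G : X → List B → Q → Prop} {R : X → Option Q}
    {V : X → List B} (h : Rep G R V) (x u q) :
    G x u q ↔ ∃ su, Sym B R x su q ∧ evalSubst V su = u := by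
  rw [h]
  constructor
  · rintro ⟨h1, h2⟩
    exact ⟨_, ⟨h1, rfl⟩, by rw [eval_reg, h2]⟩
  · rintro ⟨su, ⟨h1, rfl⟩, h2⟩
    exact ⟨h1, by rw [← h2, eval_reg]⟩

theorem next_sym (T : MarbleT A B) {G : Option T.Q → List B → T.Q → Prop}
    {R : Option T.Q → Option T.Q} {V : Option T.Q → List B} (h : Rep G R V)
    {Bs Bc} (hB : BaseEq V Bs Bc) (s : TapeSym A) (x u q') :
    next T id Bc G s x u q' ↔
      ∃ su, next T (List.map Sum.inl) Bs (Sym B R) s x su q' ∧ evalSubst V su = u := by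
  have hE : BaseEq V (fun q => Sym B R (some q)) (fun q => G (some q)) :=
    fun q u q' => h.baseEq (some q) u q'
  cases x with
  | some q => exact run_sym T hE hB s _ _ _ _
  | none =>
    constructor
    · rintro ⟨q1, u1, u2, hg, hr, rfl⟩
      obtain ⟨s1, h1, rfl⟩ := (h.baseEq _ _ _).1 hg
      obtain ⟨s2, h2, rfl⟩ := (run_sym T hE hB s _ _ _ _).1 hr
      exact ⟨_, ⟨q1, s1, s2, h1, h2, rfl⟩, eval_append _ _ _⟩
    · rintro ⟨_, ⟨q1, s1, s2, h1, h2, rfl⟩, rfl⟩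
      exact ⟨q1, _, _, (h.baseEq _ _ _).2 ⟨_, h1, rfl⟩,
        (run_sym T hE hB s _ _ _ _).2 ⟨_, h2, rfl⟩, eval_append _ _ _⟩

theorem baseR_eq (T : MarbleT A B) {X : Type} (V : X → List B) (s : TapeSym A) :
    BaseEq V (BaseR T (List.map Sum.inl) s) (BaseR T id s) := by
  intro q u q'
  constructor
  · rintro ⟨v0, h, rfl⟩
    exact ⟨_, ⟨_, h, rfl⟩, eval_inl _ _⟩
  · rintro ⟨_, ⟨v0, h, rfl⟩, rfl⟩
    exact ⟨v0, h, eval_inl _ _⟩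

theorem baseF_eq (T : MarbleT A B) {X : Type} (V : X → List B) :
    BaseEq V (BaseF T (B ⊕ X)) (BaseF T B) := by
  intro q u q'
  constructor
  · rintro ⟨h, rfl, rfl⟩
    exact ⟨_, ⟨h, rfl, rfl⟩, rfl⟩
  · rintro ⟨_, ⟨h, rfl, rfl⟩, rfl⟩
    exact ⟨h, rfl, rfl⟩

theorem exists_choice {X Q D : Type} (G : X → List D → Q → Prop) :
    ∃ (p : (X → Option Q) × (X → List D)),
      (∀ x q, p.1 x = some q → G x (p.2 x) q) ∧ (∀ x, p.1 x = none → ∀ u q, ¬ G x u q) := by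
  classical
  have : ∀ x, ∃ p : Option Q × List D, (∀ q, p.1 = some q → G x p.2 q) ∧
      (p.1 = none → ∀ u q, ¬ G x u q) := by
    intro x
    by_cases h : ∃ u q, G x u q
    · obtain ⟨u, q, h⟩ := h
      exact ⟨(some q, u), by simpa using h, by simp⟩
    · push Not at h
      exact ⟨(none, []), by simp, fun _ => h⟩
  choose g hg using this
  exact ⟨(fun x => (g x).1, fun x => (g x).2), fun x => (hg x).1, fun x => (hg x).2⟩

noncomputable def pick {X Q D : Type} (G : X → List D → Q → Prop) :
    (X → Option Q) × (X → List D) := (exists_choice G).choose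

theorem pick_some {X Q D : Type} (G : X → List D → Q → Prop) {x q}
    (h : (pick G).1 x = some q) : G x ((pick G).2 x) q := (exists_choice G).choose_spec.1 x q h

theorem pick_none {X Q D : Type} (G : X → List D → Q → Prop) {x}
    (h : (pick G).1 x = none) : ∀ u q, ¬ G x u q := (exists_choice G).choose_spec.2 x h

theorem pick_rep {X X' Q : Type} {Gs : X → List (B ⊕ X') → Q → Prop} {G : X → List B → Q → Prop}
    {V : X' → List B}
    (hf : Functional G) (h : ∀ x u q, G x u q ↔ ∃ su, Gs x su q ∧ evalSubst V su = u) :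
    Rep G (pick Gs).1 (fun x => evalSubst V ((pick Gs).2 x)) := by
  intro x u q
  constructor
  · intro hg
    cases hp : (pick Gs).1 x with
    | none =>
      obtain ⟨su, h1, _⟩ := (h _ _ _).1 hg
      exact absurd h1 (pick_none _ hp _ _)
    | some q' =>
      have := (h _ _ _).2 ⟨_, pick_some _ hp, rfl⟩
      obtain ⟨h1, h2⟩ := hf _ _ _ _ _ this hg
      exact ⟨by rw [h2], h1⟩
  · rintro ⟨h1, rfl⟩
    exact (h _ _ _).2 ⟨_, pick_some _ h1, rfl⟩

theorem pick_rep' {X Q : Type} {G : X → List B → Q → Prop} (hf : Functional G) :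
    Rep G (pick G).1 (pick G).2 := by
  intro x u q
  constructor
  · intro hg
    cases hp : (pick G).1 x with
    | none => exact absurd hg (pick_none _ hp _ _)
    | some q' =>
      obtain ⟨h1, h2⟩ := hf _ _ _ _ _ (pick_some _ hp) hg
      exact ⟨by rw [h2], h1⟩
  · rintro ⟨h1, rfl⟩
    exact pick_some _ h1

/-- The SST simulating a marble transducer. -/
noncomputable def sst (T : MarbleT A B) : SST A B :=
  letI := Classical.decEq T.Q
  { Q := Option T.Q → Option T.Q
    X := Option T.Q
    q0 := (pick (G T [] 1)).1
    init := (pick (G T [] 1)).2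
    trans := fun R a =>
      some (pick (next T (List.map Sum.inl) (BaseR T (List.map Sum.inl) (.letter a))
        (Sym B R) (.letter a)))
    out := fun R =>
      let p := pick (next T (List.map Sum.inl) (BaseF T (B ⊕ Option T.Q)) (Sym B R) .rend)
      (p.1 none).map fun _ => p.2 none }

theorem G_functional (T : MarbleT A B) (w : List A) (m : ℕ) : Functional (G T w m) := by
  induction m with
  | zero =>
    intro x u q u' q' h1 h2
    cases x with
    | some _ => exact h1.elim
    | none => obtain ⟨rfl, rfl⟩ := h1; obtain ⟨rfl, rfl⟩ := h2; simp
  | succ m ih => exact next_functional T id ih _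

theorem sst_run (T : MarbleT A B) (w : List A) : ∀ (suf pre : List A) (R V), w = pre ++ suf →
    Rep (G T w (pre.length + 1)) R V →
    ∃ R' V', (sst T).runFrom R V suf = some (R', V') ∧ Rep (G T w (w.length + 1)) R' V' := by
  intro suf
  induction suf with
  | nil =>
    rintro pre R V rfl h
    exact ⟨R, V, rfl, by simpa using h⟩
  | cons a suf ih =>
    intro pre R V hw h
    refine ih (pre ++ [a]) _ _ (by simp [hw]) ?_
    have ht : tapeAt w (pre.length + 1) = .letter a := by simp [tapeAt, hw]
    have hG : G T w ((pre ++ [a]).length + 1) =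
        next T id (BaseR T id (.letter a)) (G T w (pre.length + 1)) (.letter a) := by
      rw [← ht]; simp [G]
    have hf := G_functional T w ((pre ++ [a]).length + 1)
    rw [hG] at hf ⊢
    exact pick_rep hf (next_sym T h (baseR_eq T V _) _)

theorem sst_eval (T : MarbleT A B) (w : List A) :
    (∀ v, (sst T).eval w = some v →
      ∃ q, next T id (BaseF T B) (G T w (w.length + 1)) .rend none v q) ∧
    ((sst T).eval w = none →
      ∀ v q, ¬ next T id (BaseF T B) (G T w (w.length + 1)) .rend none v q) := by
  have h0 : Rep (G T w 1) (pick (G T [] 1)).1 (pick (G T [] 1)).2 := by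
    have : G T w 1 = G T [] 1 := by simp [G, tapeAt]
    rw [this]
    exact pick_rep' (G_functional T [] 1)
  obtain ⟨R, V, hr, hR⟩ := sst_run T w w [] _ _ rfl h0
  have hs := next_sym T hR (baseF_eq T V) .rend
  have he : (sst T).eval w = ((sst T).out R).map fun o => evalSubst V o := by
    have : (sst T).runFrom (sst T).q0 (sst T).init w = some (R, V) := hr
    rw [SST.eval, this]; rfl
  rw [he]
  simp only [sst, Option.map_map]
  cases hp : (pick (next T (List.map Sum.inl) (BaseF T (B ⊕ Option T.Q)) (Sym B R) .rend)).1 none with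
  | none =>
    refine ⟨by simp, fun _ v q hn => ?_⟩
    obtain ⟨su, h1, _⟩ := (hs _ _ _).1 hn
    exact pick_none _ hp _ _ h1
  | some q =>
    refine ⟨?_, by simp⟩
    intro v hv
    simp at hv
    subst hv
    exact ⟨q, (hs _ _ _).2 ⟨_, pick_some _ hp, rfl⟩⟩

/-! Relation with small steps -/

def push {C : Type} (o : Option C) (m : ℕ) (π : List (C × ℕ)) : List (C × ℕ) :=
  match o with
  | none => π
  | some c => (c, m) :: π

theorem marbleAt_none {C : Type} {m : ℕ} {π : List (C × ℕ)} (h : ∀ p ∈ π, m < p.2) :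
    marbleAt m π = none := by
  cases π with
  | nil => rfl
  | cons p π =>
    have := h p (by simp)
    obtain ⟨c, k⟩ := p
    simp only [marbleAt]
    rw [if_neg]
    simp at this
    omega

theorem marbleAt_push {C : Type} {m : ℕ} {π : List (C × ℕ)} (o : Option C)
    (h : ∀ p ∈ π, m < p.2) : marbleAt m (push o m π) = o := by
  cases o with
  | none => exact marbleAt_none h
  | some c => simp [push, marbleAt]

theorem Steps.trans {T : MarbleT A B} {w : List A} {c d e u v} (h1 : MarbleT.Steps T w c u d)
    (h2 : MarbleT.Steps T w d v e) : MarbleT.Steps T w c (u ++ v) e := by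
  induction h1 with
  | refl => exact h2
  | stepL ht hm _ ih => rw [List.append_assoc]; exact .stepL ht hm (ih h2)
  | stepR ht hm hw _ ih => rw [List.append_assoc]; exact .stepR ht hm hw (ih h2)
  | stepLift ht _ ih => rw [List.append_assoc]; exact .stepLift ht (ih h2)
  | stepDrop ht hm _ ih => rw [List.append_assoc]; exact .stepDrop ht hm (ih h2)

theorem run_sound (T : MarbleT A B) (w : List A) (m m' : ℕ) {E : T.Q → List B → T.Q → Prop}
    {Base : T.Q → List B → T.Q → Prop}
    (hE : ∀ q u q' π, E q u q' → (∀ p ∈ π, m ≤ p.2) →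
      1 ≤ m ∧ MarbleT.Steps T w (q, m - 1, π) u (q', m, π))
    (π : List (T.C × ℕ)) (hπ : ∀ p ∈ π, m < p.2)
    (hB : ∀ q u q', Base q u q' → MarbleT.Steps T w (q, m, π) u (q', m', π))
    {q o u q'} (h : Run T id E Base (tapeAt w m) q o u q') :
    MarbleT.Steps T w (q, m, push o m π) u (q', m', π) := by
  induction h with
  | base hb => exact hB _ _ _ hb
  | @left q o q1 q2 v u u' q' ht he hr ih =>
    have hp : ∀ p ∈ push o m π, m ≤ p.2 := by
      intro p hp
      cases o with
      | none => exact (hπ p hp).le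
      | some c =>
        simp only [push, List.mem_cons] at hp
        rcases hp with rfl | hp
        · exact le_rfl
        · exact (hπ p hp).le
    obtain ⟨h1, h2⟩ := hE _ _ _ _ he hp
    exact .stepL (by rw [marbleAt_push o hπ]; exact ht) h1 (Steps.trans h2 ih)
  | drop ht hr ih => exact .stepDrop (marbleAt_none hπ) ht ih
  | lift ht hr ih => exact .stepLift ht ih

theorem G_sound (T : MarbleT A B) (w : List A) (m : ℕ) (hm : m ≤ w.length + 1) :
    (∀ u q, G T w m none u q → MarbleT.Steps T w (T.q0, 0, []) u (q, m, [])) ∧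
    (∀ q u q' π, G T w m (some q) u q' → (∀ p ∈ π, m ≤ p.2) →
      1 ≤ m ∧ MarbleT.Steps T w (q, m - 1, π) u (q', m, π)) := by
  induction m with
  | zero =>
    constructor
    · rintro u q ⟨rfl, rfl⟩
      exact .refl _
    · intro q u q' π h
      exact h.elim
  | succ m ih =>
    obtain ⟨ih1, ih2⟩ := ih (by omega)
    have key : ∀ π : List (T.C × ℕ), (∀ p ∈ π, m < p.2) → ∀ q u q',
        Run T id (fun q => G T w m (some q)) (BaseR T id (tapeAt w m)) (tapeAt w m) q none u q' →
        MarbleT.Steps T w (q, m, π) u (q', m + 1, π) := by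
      intro π hπ q u q' hr
      refine run_sound T w m (m + 1) ih2 π hπ ?_ hr
      rintro q u q' ⟨v0, ht, rfl⟩
      have := MarbleT.Steps.stepR (marbleAt_none hπ) ht (by omega)
        (MarbleT.Steps.refl (T := T) (w := w) (q', m + 1, π))
      simpa using this
    constructor
    · rintro u q ⟨q1, u1, u2, hg, hr, rfl⟩
      exact Steps.trans (ih1 _ _ hg) (key [] (by simp) _ _ _ hr)
    · intro q u q' π h hπ
      exact ⟨by omega, key π (fun p hp => hπ p hp) _ _ _ h⟩

theorem tapeAt_end (w : List A) : tapeAt w (w.length + 1) = .rend := by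
  simp [tapeAt]

theorem fin_sound (T : MarbleT A B) (w : List A) {v q}
    (h : next T id (BaseF T B) (G T w (w.length + 1)) .rend none v q) :
    ∃ q ∈ T.final, MarbleT.Steps T w (T.q0, 0, []) v (q, w.length + 1, []) := by
  obtain ⟨h1, h2⟩ := G_sound T w (w.length + 1) le_rfl
  obtain ⟨q1, u1, u2, hg, hr, rfl⟩ := h
  have hq : ∀ {q o u q'}, Run T id (fun q => G T w (w.length + 1) (some q)) (BaseF T B) .rend
      q o u q' → q' ∈ T.final := by
    intro q o u q' h
    induction h with
    | base hb => obtain ⟨h, rfl, _⟩ := hb; exact h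
    | left _ _ _ ih => exact ih
    | drop _ _ ih => exact ih
    | lift _ _ ih => exact ih
  refine ⟨q, hq hr, Steps.trans (h1 _ _ hg) ?_⟩
  rw [← tapeAt_end w] at hr
  refine run_sound T w _ _ h2 [] (by simp) ?_ hr
  rintro q u q' ⟨_, rfl, rfl⟩
  exact .refl _

/-- Big-step description of accepting runs from a configuration. -/
inductive Big (T : MarbleT A B) (w : List A) : ℕ → T.Q → List (T.C × ℕ) → List B → Prop
  | fin {q o u q'} : Run T id (fun q => G T w (w.length + 1) (some q)) (BaseF T B)
      (tapeAt w (w.length + 1)) q o u q' → Big T w (w.length + 1) q (push o (w.length + 1) []) u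
  | up {m q o u1 q' π u2} : m ≤ w.length → (∀ p ∈ π, m < p.2) →
      Run T id (fun q => G T w m (some q)) (BaseR T id (tapeAt w m)) (tapeAt w m) q o u1 q' →
      Big T w (m + 1) q' π u2 → Big T w m q (push o m π) (u1 ++ u2)

/-- Replacing the head of a big step run. -/
theorem Big.prepend {T : MarbleT A B} {w : List A} {m : ℕ} {q q0 : T.Q} {π π0 : List (T.C × ℕ)}
    {u v : List B} {o o' : Option T.C} (h : Big T w m q π u)
    (hπ0 : ∀ p ∈ π0, m < p.2) (hπ : π = push o m π0)
    (hr : ∀ Base u' q', Run T id (fun q => G T w m (some q)) Base (tapeAt w m) q o u' q' →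
      Run T id (fun q => G T w m (some q)) Base (tapeAt w m) q0 o' (v ++ u') q') :
    Big T w m q0 (push o' m π0) (v ++ u) := by
  have key : ∀ (m : ℕ) (o o' : Option T.C) (π π' : List (T.C × ℕ)), (∀ p ∈ π, m < p.2) →
      (∀ p ∈ π', m < p.2) → push o m π = push o' m π' → o = o' ∧ π = π' := by
    intro m o o' π π' h1 h2 he
    have ho : o = o' := by
      rw [← marbleAt_push o h1, he, marbleAt_push o' h2]
    subst ho
    refine ⟨rfl, ?_⟩
    cases o with
    | none => exact he
    | some c => simpa [push] using he
  cases h with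
  | fin hrun =>
    obtain ⟨rfl, rfl⟩ := key _ _ _ _ _ (by simp) hπ0 hπ
    exact .fin (hr _ _ _ hrun)
  | up hm hlt hrun hb =>
    obtain ⟨rfl, rfl⟩ := key _ _ _ _ _ hlt hπ0 hπ
    rw [← List.append_assoc]
    exact .up hm hlt (hr _ _ _ hrun) hb

theorem steps_big (T : MarbleT A B) (w : List A) {c u cf} (h : MarbleT.Steps T w c u cf) :
    (∃ qf ∈ T.final, cf = (qf, w.length + 1, [])) → c.2.1 ≤ w.length + 1 →
    (∀ p ∈ c.2.2, c.2.1 ≤ p.2) → c.2.2.Pairwise (fun a b => a.2 < b.2) →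
    Big T w c.2.1 c.1 c.2.2 u := by
  have strict : ∀ (m : ℕ) (π : List (T.C × ℕ)), (∀ p ∈ π, m ≤ p.2) →
      π.Pairwise (fun a b => a.2 < b.2) → ∃ o π', π = push o m π' ∧ (∀ p ∈ π', m < p.2) := by
    intro m π h1 h2
    cases π with
    | nil => exact ⟨none, [], rfl, by simp⟩
    | cons p π =>
      obtain ⟨c, k⟩ := p
      rw [List.pairwise_cons] at h2
      have hk : m ≤ k := h1 (c, k) (by simp)
      by_cases hmk : m = k
      · subst hmk
        exact ⟨some c, π, rfl, fun p hp => h2.1 p hp⟩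
      · refine ⟨none, (c, k) :: π, rfl, ?_⟩
        intro p hp
        rcases List.mem_cons.1 hp with rfl | hp
        · simp; omega
        · have := h2.1 p hp
          simp at this
          omega
  have strict0 : ∀ (m : ℕ) (π : List (T.C × ℕ)), (∀ p ∈ π, m ≤ p.2) →
      π.Pairwise (fun a b => a.2 < b.2) → marbleAt m π = none → (∀ p ∈ π, m < p.2) := by
    intro m π h1 h2 h3
    obtain ⟨o, π', rfl, h⟩ := strict m π h1 h2
    rw [marbleAt_push o h] at h3
    subst h3
    exact h
  induction h with
  | refl c =>
    rintro ⟨qf, hqf, rfl⟩ _ _ _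
    exact Big.fin (o := none) (.base ⟨hqf, rfl, rfl⟩)
  | @stepL q m π q' v u cf ht hm hs ih =>
    intro hf hle hge hpw
    simp only at hle hge hpw ⊢
    have hb := ih hf (by simp; omega) (fun p hp => by have := hge p hp; simp; omega) hpw
    simp only at hb
    obtain ⟨o, π', rfl, hπ'⟩ := strict m π hge hpw
    rw [marbleAt_push o hπ'] at ht
    generalize hk : m - 1 = k at hb
    obtain rfl : m = k + 1 := by omega
    generalize hst : push o (k + 1) π' = σ at hb hge hpw
    cases hb with
    | fin => omega
    | @up _ _ o2 u1 q2 π2 u2 hk' hlt hrun hb2 =>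
      have ho2 : o2 = none := by
        cases o2 with
        | none => rfl
        | some c => have := hge (c, k) (by simp [push]); simp at this
      subst ho2
      have hσ : push none k π2 = π2 := rfl
      rw [hσ] at hst ⊢
      subst hst
      have := Big.prepend (o' := o) (v := v ++ u1) (q0 := q) hb2 hπ' rfl (fun Base u' q' hr => by
        have := Run.left ht (E := fun q => G T w (k + 1) (some q)) (h := id) hrun hr
        simpa using this)
      simpa using this
  | @stepR q m π q' v u cf hn ht hm hs ih =>
    intro hf hle hge hpw
    simp only at hle hge hpw ⊢
    have hlt := strict0 m π hge hpw hn
    have hb := ih hf (by simp; omega) hlt hpw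
    exact Big.up (o := none) hm hlt (.base ⟨v, ht, rfl⟩) hb
  | @stepLift q m π q' cc v u cf ht hs ih =>
    intro hf hle hge hpw
    simp only [List.pairwise_cons] at hle hge hpw ⊢
    have hlt : ∀ p ∈ π, m < p.2 := hpw.1
    have hb := ih hf hle (fun p hp => (hlt p hp).le) hpw.2
    exact Big.prepend (o := none) (o' := some cc) hb hlt rfl
      (fun Base u' q' hr => Run.lift (h := id) ht hr)
  | @stepDrop q m π q' cc v u cf hn ht hs ih =>
    intro hf hle hge hpw
    simp only at hle hge hpw ⊢
    have hlt := strict0 m π hge hpw hn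
    have hb := ih hf hle (by
      intro p hp
      rcases List.mem_cons.1 hp with rfl | hp
      · simp
      · exact hge p hp) (List.pairwise_cons.2 ⟨fun p hp => hlt p hp, hpw⟩)
    exact Big.prepend (o := some cc) (o' := none) hb hlt rfl
      (fun Base u' q' hr => Run.drop (h := id) ht hr)

theorem big_fin (T : MarbleT A B) (w : List A) {m q π u} (h : Big T w m q π u) :
    π = [] → ∀ u1, G T w m none u1 q →
    ∃ qf, next T id (BaseF T B) (G T w (w.length + 1)) .rend none (u1 ++ u) qf := by
  induction h with
  | @fin q o u q' hr =>
    intro hπ u1 hg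
    rw [tapeAt_end] at hr
    cases o with
    | some c => simp [push] at hπ
    | none => exact ⟨q', q, u1, u, hg, hr, rfl⟩
  | @up m q o u1 q' π u2 hm hlt hr hb ih =>
    intro hπ u0 hg
    cases o with
    | some c => simp [push] at hπ
    | none =>
      rw [← List.append_assoc]
      exact ih hπ (u0 ++ u1) ⟨q, u0, u1, hg, hr, rfl⟩

theorem main (T : MarbleT A B) (f : List A → Option (List B)) (h : T.Computes f) :
    (sst T).Computes f := by
  intro w
  obtain ⟨h1, h2⟩ := sst_eval T w
  cases he : (sst T).eval w with
  | some v =>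
    obtain ⟨q, hq⟩ := h1 v he
    exact ((h w v).2 (fin_sound T w hq)).symm
  | none =>
    cases hf : f w with
    | none => rfl
    | some v =>
      obtain ⟨q, hq, hs⟩ := (h w v).1 hf
      have hb := steps_big T w hs ⟨q, hq, rfl⟩ (by simp) (by simp) (by simp)
      obtain ⟨qf, hqf⟩ := big_fin T w hb rfl [] ⟨rfl, rfl⟩
      exact absurd hqf (h2 he _ _)

end MarbleToSST

/-! ### From SSTs to marble transducers -/

namespace SSTToMarble

variable {A B : Type}

/-- Words of bounded length over letters and registers. -/
abbrev Wd (S : SST A B) (N : ℕ) : Type := {l : List (B ⊕ S.X) // l.length ≤ N}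

def mk (S : SST A B) (N : ℕ) (l : List (B ⊕ S.X)) : Wd S N :=
  ⟨l.take N, by simp⟩

theorem mk_val {S : SST A B} {N : ℕ} {l : List (B ⊕ S.X)} (h : l.length ≤ N) :
    (mk S N l).1 = l := by
  simp [mk, h]

/-- States: compute the SST state moving right; go back to the left endmarker; produce the
value of a register; return to the caller; process the rest of a word. -/
inductive St (S : SST A B) (N : ℕ) : Type
  | fwd (q : S.Q)
  | goL
  | eval (x : S.X)
  | ret
  | proc (l : Wd S N)

/-- Colors: a pending register or the rest of a word. -/
inductive Col (S : SST A B) (N : ℕ) : Type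
  | pend (x : S.X)
  | rest (l : Wd S N)

theorem finite_wd [Fintype B] (S : SST A B) (N : ℕ) : Finite (Wd S N) :=
  (List.finite_length_le (B ⊕ S.X) N).to_subtype

theorem finite_st [Fintype B] (S : SST A B) (N : ℕ) : Finite (St S N) := by
  have := finite_wd S N
  let g : St S N → (S.Q ⊕ S.X) ⊕ (Wd S N ⊕ Bool) := fun s => match s with
    | .fwd q => .inl (.inl q)
    | .eval x => .inl (.inr x)
    | .proc l => .inr (.inl l)
    | .goL => .inr (.inr true)
    | .ret => .inr (.inr false)
  refine Finite.of_injective g ?_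
  intro a b h
  cases a <;> cases b <;> simp_all [g]

theorem finite_col [Fintype B] (S : SST A B) (N : ℕ) : Finite (Col S N) := by
  have := finite_wd S N
  let g : Col S N → S.X ⊕ Wd S N := fun s => match s with
    | .pend x => .inl x
    | .rest l => .inr l
  refine Finite.of_injective g ?_
  intro a b h
  cases a <;> cases b <;> simp_all [g]

def trans (S : SST A B) (N : ℕ) : St S N → TapeSym A → Option (Col S N) →
    Option ((St S N × MAct (Col S N)) × List B)
  | .fwd q, .lend, none => some ((.fwd q, .right), [])
  | .fwd q, .letter a, none => (S.trans q a).map fun p => ((.fwd p.1, .right), [])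
  | .fwd q, .letter a, some (.pend x) =>
      (S.trans q a).map fun p => ((.proc (mk S N (p.2 x)), .lift), [])
  | .fwd q, .rend, none => (S.out q).map fun o => ((.ret, .drop (.rest (mk S N o))), [])
  | .goL, .lend, none => some ((.fwd S.q0, .right), [])
  | .goL, .letter _, _ => some ((.goL, .left), [])
  | .eval x, .lend, none => some ((.ret, .right), S.init x)
  | .eval x, .letter _, none => some ((.goL, .drop (.pend x)), [])
  | .eval x, _, some (.rest _) => some ((.eval x, .left), [])
  | .ret, _, some (.rest l) => some ((.proc l, .lift), [])
  | .proc ⟨[], _⟩, .letter _, none => some ((.ret, .right), [])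
  | .proc ⟨.inl b :: l, _⟩, _, none => some ((.ret, .drop (.rest (mk S N l))), [b])
  | .proc ⟨.inr x :: l, _⟩, _, none => some ((.eval x, .drop (.rest (mk S N l))), [])
  | _, _, _ => none

/-- The marble transducer simulating an SST. -/
noncomputable def marble [Fintype B] (S : SST A B) (N : ℕ) : MarbleT A B :=
  letI := finite_st S N
  letI := finite_col S N
  { Q := St S N
    C := Col S N
    finQ := Fintype.ofFinite _
    finC := Fintype.ofFinite _
    q0 := .fwd S.q0
    final := {.proc (mk S N [])}
    trans := trans S N
    marble_left_or_lift := by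
      intro q s c p h
      rcases q with q | _ | x | _ | ⟨_ | ⟨_ | _, _⟩, _⟩ <;> rcases s with _ | _ | a <;>
        rcases c with x | l <;> simp [trans] at h <;>
        first
        | (subst h; simp)
        | (obtain ⟨_, _, _, rfl⟩ := h; simp) }

section

variable [Fintype B] {S : SST A B} {N : ℕ} {w : List A}

/-- Configuration reachability in the simulating machine. -/
abbrev Stp (S : SST A B) (N : ℕ) (w : List A) (c : St S N × ℕ × List (Col S N × ℕ))
    (u : List B) (d : St S N × ℕ × List (Col S N × ℕ)) : Prop :=
  MarbleT.Steps (marble S N) w c u d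

theorem stL {q q' : St S N} {m π v u cf}
    (h : trans S N q (tapeAt w (m + 1)) (marbleAt (m + 1) π) = some ((q', .left), v))
    (hs : Stp S N w (q', m, π) u cf) : Stp S N w (q, m + 1, π) (v ++ u) cf :=
  MarbleT.Steps.stepL (T := marble S N) h (by omega) hs

theorem stR {q q' : St S N} {m π v u cf} (hn : marbleAt m π = none)
    (h : trans S N q (tapeAt w m) none = some ((q', .right), v)) (hm : m ≤ w.length)
    (hs : Stp S N w (q', m + 1, π) u cf) : Stp S N w (q, m, π) (v ++ u) cf :=
  MarbleT.Steps.stepR (T := marble S N) hn h hm hs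

theorem stLift {q q' : St S N} {m π c v u cf}
    (h : trans S N q (tapeAt w m) (some c) = some ((q', .lift), v))
    (hs : Stp S N w (q', m, π) u cf) : Stp S N w (q, m, (c, m) :: π) (v ++ u) cf :=
  MarbleT.Steps.stepLift (T := marble S N) h hs

theorem stDrop {q q' : St S N} {m π c v u cf} (hn : marbleAt m π = none)
    (h : trans S N q (tapeAt w m) none = some ((q', .drop c), v))
    (hs : Stp S N w (q', m, (c, m) :: π) u cf) : Stp S N w (q, m, π) (v ++ u) cf :=
  MarbleT.Steps.stepDrop (T := marble S N) hn h hs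

theorem tape_letter {k : ℕ} {a : A} (h : w[k]? = some a) : tapeAt w (k + 1) = .letter a := by
  simp [tapeAt, h]

theorem tape_zero : tapeAt w 0 = .lend := by simp [tapeAt]

theorem goL_steps (k : ℕ) (hk : k ≤ w.length) (π : List (Col S N × ℕ))
    (hπ : ∀ p ∈ π, 0 < p.2) : Stp S N w (.goL, k, π) [] (.fwd S.q0, 1, π) := by
  induction k with
  | zero =>
    exact stR (v := []) (MarbleToSST.marbleAt_none hπ) (by rw [tape_zero]; rfl) (by omega)
      (.refl _)
  | succ k ih =>
    refine stL (v := []) ?_ (ih (by omega))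
    rw [tape_letter (List.getElem?_eq_getElem (show k < w.length by omega))]
    rfl

/-- The state and valuation of the SST after the first `k` letters. -/
def after (S : SST A B) (w : List A) (k : ℕ) : Option (S.Q × (S.X → List B)) :=
  S.runFrom S.q0 S.init (w.take k)

theorem runFrom_snoc (u : List A) (a : A) (q : S.Q) (v : S.X → List B) :
    S.runFrom q v (u ++ [a]) = (S.runFrom q v u).bind fun p =>
      (S.trans p.1 a).map fun t => (t.1, fun x => evalSubst p.2 (t.2 x)) := by
  induction u generalizing q v with
  | nil =>
    simp only [List.nil_append, SST.runFrom, Option.bind_some]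
    cases S.trans q a with
    | none => rfl
    | some p => rfl
  | cons b u ih =>
    simp only [List.cons_append, SST.runFrom]
    cases S.trans q b with
    | none => rfl
    | some p => exact ih _ _

theorem after_succ {k : ℕ} {a : A} (h : w[k]? = some a) :
    after S w (k + 1) = (after S w k).bind fun p =>
      (S.trans p.1 a).map fun t => (t.1, fun x => evalSubst p.2 (t.2 x)) := by
  rw [after, after, List.take_add_one, h]
  exact runFrom_snoc _ _ _ _

theorem after_succ_some {k : ℕ} {p : S.Q × (S.X → List B)} (hk : k + 1 ≤ w.length)
    (h : after S w (k + 1) = some p) :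
    ∃ a q v s, w[k]? = some a ∧ after S w k = some (q, v) ∧ S.trans q a = some (p.1, s) ∧
      p.2 = fun x => evalSubst v (s x) := by
  have ha := List.getElem?_eq_getElem (show k < w.length by omega)
  rw [after_succ ha] at h
  simp only [Option.bind_eq_some_iff, Option.map_eq_some_iff] at h
  obtain ⟨⟨q, v⟩, h1, ⟨q', s⟩, h2, rfl⟩ := h
  exact ⟨_, q, v, s, ha, h1, h2, rfl⟩

theorem fwd_steps (k : ℕ) (hk : k ≤ w.length) (π : List (Col S N × ℕ))
    (hπ : ∀ p ∈ π, k < p.2) (q v) (h : after S w k = some (q, v)) :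
    Stp S N w (.fwd S.q0, 1, π) [] (.fwd q, k + 1, π) := by
  induction k generalizing q v with
  | zero =>
    simp only [after, List.take_zero, SST.runFrom, Option.some.injEq, Prod.mk.injEq] at h
    obtain ⟨rfl, _⟩ := h
    exact .refl _
  | succ k ih =>
    obtain ⟨a, q1, v1, s, ha, h1, h2, _⟩ := after_succ_some hk h
    have := ih (by omega) (fun p hp => by have := hπ p hp; omega) q1 v1 h1
    refine MarbleToSST.Steps.trans this ?_
    refine stR (v := []) (MarbleToSST.marbleAt_none hπ) ?_ (by omega) (.refl _)
    rw [tape_letter ha]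
    simp [trans, h2]

/-- Specification of the subroutine producing the value of a register. -/
def EvalSpec (S : SST A B) (N : ℕ) (w : List A) (m : ℕ) (v : S.X → List B) : Prop :=
  ∀ (x : S.X) (π : List (Col S N × ℕ)), (∀ p ∈ π, m < p.2) →
    Stp S N w (.eval x, m, π) (v x) (.ret, m + 1, π)

theorem ret_lift {m : ℕ} {l : Wd S N} {π : List (Col S N × ℕ)} {u cf}
    (h : Stp S N w (.proc l, m, π) u cf) :
    Stp S N w (.ret, m, (.rest l, m) :: π) u cf :=
  stLift (v := []) (by simp [trans]) h

theorem proc_steps (m : ℕ) (v : S.X → List B) (he : EvalSpec S N w m v)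
    (π : List (Col S N × ℕ)) (hπ : ∀ p ∈ π, m + 1 < p.2) (l : List (B ⊕ S.X))
    (hl : l.length ≤ N) :
    Stp S N w (.proc (mk S N l), m + 1, π) (evalSubst v l) (.proc (mk S N []), m + 1, π) := by
  have hn := MarbleToSST.marbleAt_none hπ
  induction l with
  | nil => exact .refl _
  | cons c l ih =>
    have ih := ih (by simp at hl; omega)
    have hmk : mk S N (c :: l) = ⟨c :: l, hl⟩ := Subtype.ext (mk_val hl)
    rw [hmk]
    cases c with
    | inl b =>
      have e : evalSubst v (.inl b :: l) = [b] ++ evalSubst v l := by simp [evalSubst]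
      rw [e]
      exact stDrop hn (by simp [trans]) (ret_lift ih)
    | inr x =>
      have e : evalSubst v (.inr x :: l) = [] ++ ([] ++ (v x ++ evalSubst v l)) := by
        simp [evalSubst]
      rw [e]
      refine stDrop (c := .rest (mk S N l)) (q' := .eval x) hn (by simp [trans]) ?_
      refine stL (q' := .eval x) (by cases h : tapeAt w (m + 1) <;> simp [trans, marbleAt]) ?_
      refine MarbleToSST.Steps.trans (he x _ ?_) (ret_lift ih)
      intro p hp
      rcases List.mem_cons.1 hp with rfl | hp
      · simp
      · have := hπ p hp
        omega

theorem eval_steps (hN : ∀ q a p, S.trans q a = some p → ∀ x, (p.2 x).length ≤ N)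
    (m : ℕ) (hm : m ≤ w.length) (q v) (h : after S w m = some (q, v)) :
    EvalSpec S N w m v := by
  induction m generalizing q v with
  | zero =>
    intro x π hπ
    simp only [after, List.take_zero, SST.runFrom, Option.some.injEq, Prod.mk.injEq] at h
    obtain ⟨_, rfl⟩ := h
    have := stR (S := S) (N := N) (q := .eval x) (w := w) (MarbleToSST.marbleAt_none hπ)
      (by rw [tape_zero]; rfl) (by omega) (.refl _)
    simpa using this
  | succ m ih =>
    intro x π hπ
    obtain ⟨a, q1, v1, s, ha, h1, h2, hv⟩ := after_succ_some hm h
    simp only at hv h2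
    have ih := ih (by omega) q1 v1 h1
    have ht := tape_letter ha
    have hn := MarbleToSST.marbleAt_none hπ
    have hlt : ∀ p ∈ ((Col.pend x, m + 1) :: π : List (Col S N × ℕ)), m < p.2 := by
      intro p hp
      rcases List.mem_cons.1 hp with rfl | hp
      · simp
      · have := hπ p hp
        omega
    have e : v x = [] ++ ([] ++ ([] ++ ([] ++ (evalSubst v1 (s x) ++ ([] ++ []))))) := by
      simp [hv]
    rw [e]
    refine stDrop (c := .pend x) (q' := .goL) hn (by rw [ht]; rfl) ?_
    refine MarbleToSST.Steps.trans (goL_steps (m + 1) hm _ (fun p hp => by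
      have := hlt p hp; omega)) ?_
    refine MarbleToSST.Steps.trans (fwd_steps m (by omega) _ hlt q1 v1 h1) ?_
    refine stLift (q' := .proc (mk S N (s x))) (by rw [ht]; simp [trans, h2]) ?_
    refine MarbleToSST.Steps.trans (proc_steps m v1 ih π hπ (s x) (hN _ _ _ h2 x)) ?_
    have hnil : mk S N [] = ⟨[], by simp⟩ := Subtype.ext (mk_val (by simp))
    exact stR hn (by rw [ht, hnil]; rfl) hm (.refl _)

/-- A halting configuration. -/
def Stuck (T : MarbleT A B) (w : List A) (d : T.Q × ℕ × List (T.C × ℕ)) : Prop :=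
  ∀ u e, MarbleT.Steps T w d u e → u = [] ∧ e = d

theorem stuck_of {T : MarbleT A B} {q : T.Q} {m : ℕ}
    (h : T.trans q (tapeAt w m) none = none) : Stuck T w (q, m, []) := by
  intro u e hs
  cases hs with
  | refl => simp
  | stepL ht => simp [marbleAt, h] at ht
  | stepR _ ht => simp [h] at ht
  | stepDrop _ ht => simp [h] at ht

theorem steps_det {T : MarbleT A B} {c d u} (h : MarbleT.Steps T w c u d) (hd : Stuck T w d) :
    ∀ {v e}, MarbleT.Steps T w c v e → Stuck T w e → u = v ∧ d = e := by
  induction h with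
  | refl c =>
    intro v e h2 _
    obtain ⟨rfl, rfl⟩ := hd _ _ h2
    simp
  | @stepL q m π q' v u cf ht hm hs ih =>
    intro v' e h2 he
    cases h2 with
    | refl =>
      have := (he _ _ (.stepL ht hm hs))
      simp only [List.append_eq_nil_iff] at this
      obtain ⟨⟨rfl, rfl⟩, rfl⟩ := this
      simp
    | stepL ht' hm' hs' =>
      rw [ht] at ht'
      simp only [Option.some.injEq, Prod.mk.injEq, and_true] at ht'
      obtain ⟨rfl, rfl⟩ := ht'
      obtain ⟨rfl, rfl⟩ := ih hd hs' he
      simp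
    | stepR hn ht' => simp_all
    | stepLift ht' => simp_all [marbleAt]
    | stepDrop hn ht' => simp_all
  | @stepR q m π q' v u cf hn ht hm hs ih =>
    intro v' e h2 he
    cases h2 with
    | refl =>
      have := (he _ _ (.stepR hn ht hm hs))
      simp only [List.append_eq_nil_iff] at this
      obtain ⟨⟨rfl, rfl⟩, rfl⟩ := this
      simp
    | stepL ht' hm' hs' => simp_all
    | stepR hn ht' hm' hs' =>
      rw [ht] at ht'
      simp only [Option.some.injEq, Prod.mk.injEq, and_true] at ht'
      obtain ⟨rfl, rfl⟩ := ht'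
      obtain ⟨rfl, rfl⟩ := ih hd hs' he
      simp
    | stepLift ht' => simp_all [marbleAt]
    | stepDrop hn ht' => simp_all
  | @stepLift q m π q' cc v u cf ht hs ih =>
    intro v' e h2 he
    cases h2 with
    | refl =>
      have := (he _ _ (.stepLift ht hs))
      simp only [List.append_eq_nil_iff] at this
      obtain ⟨⟨rfl, rfl⟩, rfl⟩ := this
      simp
    | stepL ht' hm' hs' => simp_all [marbleAt]
    | stepR hn ht' hm' hs' => simp_all [marbleAt]
    | stepLift ht' hs' =>
      rw [ht] at ht'
      simp only [Option.some.injEq, Prod.mk.injEq, and_true] at ht'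
      obtain ⟨rfl, rfl⟩ := ht'
      obtain ⟨rfl, rfl⟩ := ih hd hs' he
      simp
    | stepDrop hn ht' => simp_all [marbleAt]
  | @stepDrop q m π q' cc v u cf hn ht hs ih =>
    intro v' e h2 he
    cases h2 with
    | refl =>
      have := (he _ _ (.stepDrop hn ht hs))
      simp only [List.append_eq_nil_iff] at this
      obtain ⟨⟨rfl, rfl⟩, rfl⟩ := this
      simp
    | stepL ht' hm' hs' => simp_all
    | stepR hn ht' hm' hs' => simp_all
    | stepLift ht' => simp_all [marbleAt]
    | stepDrop hn' ht' hs' =>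
      rw [ht] at ht'
      simp only [Option.some.injEq, Prod.mk.injEq, MAct.drop.injEq] at ht'
      obtain ⟨⟨rfl, rfl⟩, rfl⟩ := ht'
      obtain ⟨rfl, rfl⟩ := ih hd hs' he
      simp

theorem after_none (k : ℕ) (hk : k ≤ w.length) (h : after S w k = none) :
    ∃ j q v a, j < w.length ∧ after S w j = some (q, v) ∧ w[j]? = some a ∧ S.trans q a = none := by
  induction k with
  | zero => simp [after, SST.runFrom] at h
  | succ k ih =>
    cases hp : after S w k with
    | none => exact ih (by omega) hp
    | some p =>
      have ha := List.getElem?_eq_getElem (show k < w.length by omega)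
      rw [after_succ ha, hp] at h
      simp only [Option.bind_some, Option.map_eq_none_iff] at h
      exact ⟨k, p.1, p.2, _, by omega, hp, ha, h⟩

theorem start_steps (k : ℕ) (hk : k ≤ w.length) (q v) (h : after S w k = some (q, v)) :
    Stp S N w (.fwd S.q0, 0, []) [] (.fwd q, k + 1, []) :=
  stR (v := []) rfl (by rw [tape_zero]; rfl) (by omega) (fwd_steps k hk [] (by simp) q v h)

theorem acc_stuck : Stuck (marble S N) w (St.proc (mk S N []), w.length + 1, []) := by
  apply stuck_of
  rw [MarbleToSST.tapeAt_end]
  have : mk S N [] = ⟨[], by simp⟩ := Subtype.ext (mk_val (by simp))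
  rw [this]
  rfl

theorem eval_some (hN : ∀ q a p, S.trans q a = some p → ∀ x, (p.2 x).length ≤ N)
    (hO : ∀ q o, S.out q = some o → o.length ≤ N) {u} (h : S.eval w = some u) :
    ∃ cf, cf = (St.proc (mk S N []), w.length + 1, []) ∧ Stp S N w (.fwd S.q0, 0, []) u cf := by
  simp only [SST.eval, Option.bind_eq_some_iff, Option.map_eq_some_iff] at h
  obtain ⟨⟨q, v⟩, h1, o, h2, rfl⟩ := h
  refine ⟨_, rfl, ?_⟩
  have hw : after S w w.length = some (q, v) := by rw [after, List.take_length]; exact h1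
  have e : evalSubst v o = [] ++ ([] ++ evalSubst v o) := by simp
  simp only
  rw [e]
  refine MarbleToSST.Steps.trans (start_steps w.length le_rfl q v hw) ?_
  refine stDrop (q' := .ret) (c := .rest (mk S N o)) rfl
    (by rw [MarbleToSST.tapeAt_end]; simp [trans, h2]) (ret_lift ?_)
  exact proc_steps w.length v (eval_steps hN _ le_rfl q v hw) [] (by simp) o (hO _ _ h2)

theorem eval_none (h : S.eval w = none) :
    ∃ q m, Stp S N w (.fwd S.q0, 0, []) [] (.fwd q, m, []) ∧
      Stuck (marble S N) w (St.fwd q, m, []) := by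
  cases hr : S.runFrom S.q0 S.init w with
  | none =>
    have hw : after S w w.length = none := by rw [after, List.take_length]; exact hr
    obtain ⟨j, q, v, a, hj, h1, ha, h2⟩ := after_none _ le_rfl hw
    refine ⟨q, j + 1, start_steps j hj.le q v h1, stuck_of ?_⟩
    rw [tape_letter ha]
    simp [marble, trans, h2]
  | some p =>
    obtain ⟨q, v⟩ := p
    have hw : after S w w.length = some (q, v) := by rw [after, List.take_length]; exact hr
    refine ⟨q, w.length + 1, start_steps _ le_rfl q v hw, stuck_of ?_⟩
    rw [MarbleToSST.tapeAt_end]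
    simp [SST.eval, hr] at h
    simp [marble, trans, h]

end

theorem exists_bound [Fintype A] (S : SST A B) :
    ∃ N, (∀ q a p, S.trans q a = some p → ∀ x, (p.2 x).length ≤ N) ∧
      (∀ q o, S.out q = some o → o.length ≤ N) := by
  obtain ⟨N1, h1⟩ := (Set.finite_range fun t : S.Q × A × S.X =>
    match S.trans t.1 t.2.1 with
    | none => 0
    | some p => (p.2 t.2.2).length).bddAbove
  obtain ⟨N2, h2⟩ := (Set.finite_range fun q : S.Q =>
    match S.out q with
    | none => 0
    | some o => o.length).bddAbove
  refine ⟨max N1 N2, ?_, ?_⟩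
  · intro q a p h x
    have := h1 ⟨(q, a, x), rfl⟩
    simp only [h] at this
    exact le_max_of_le_left this
  · intro q o h
    have := h2 ⟨q, rfl⟩
    simp only [h] at this
    exact le_max_of_le_right this

theorem main [Fintype A] [Fintype B] (S : SST A B) (f : List A → Option (List B))
    (h : S.Computes f) : ∃ T : MarbleT A B, T.Computes f := by
  obtain ⟨N, hN, hO⟩ := exists_bound S
  refine ⟨marble S N, ?_⟩
  intro w v
  rw [← h w]
  constructor
  · intro he
    obtain ⟨_, rfl, hs⟩ := eval_some hN hO he
    exact ⟨_, rfl, hs⟩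
  · rintro ⟨q, rfl, hs⟩
    cases he : S.eval w with
    | none =>
      obtain ⟨q, m, hs', hst⟩ := eval_none (N := N) he
      have := (steps_det hs acc_stuck hs' hst).2
      exact absurd (congrArg Prod.fst this) (by intro hh; cases hh)
    | some u =>
      obtain ⟨_, rfl, hs'⟩ := eval_some hN hO he
      rw [(steps_det hs acc_stuck hs' acc_stuck).1]

end SSTToMarble

theorem stmt1 {A B : Type} [Fintype A] [Fintype B] (f : List A → Option (List B)) :
    (∃ T : MarbleT A B, T.Computes f) ↔ (∃ S : SST A B, S.Computes f) := by
  constructor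
  · rintro ⟨T, hT⟩
    exact ⟨_, MarbleToSST.main T f hT⟩
  · rintro ⟨S, hS⟩
    exact SSTToMarble.main S f hS
end
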